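/- For each k let μ_k be a signed Radon measure on the unit disk D and let u_k ∈ L¹(D) weakly solve −Δu_k = μ_k. Assume μ_k converges weakly to a Radon measure μ and u_k → u in L¹(D). Then: (1) u weakly solves −Δu = μ, and for every q ∈ (1,2) the sequence u_k converges to u weakly in W^{1,q}_loc(D); (2) if in addition |μ_k|(D) → 0, then u_k → u strongly in W^{1,q}_loc(D) for every q ∈ [1,2), and u is a harmonic function on D. -/

import Mathlib

open MeasureTheory Metric Set Filter
open scoped Topology ENNReal NNReal BigOperators

noncomputable section

abbrev E2 : Type := EuclideanSpace ℝ (Fin 2)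

/-- Smooth compactly supported test function. -/
def IsTest (φ : E2 → ℝ) : Prop := ContDiff ℝ (⊤ : ℕ∞) φ ∧ HasCompactSupport φ

/-- Euclidean Laplacian. -/
def lap (φ : E2 → ℝ) (x : E2) : ℝ :=
  ∑ i : Fin 2, fderiv ℝ (fun y => fderiv ℝ φ y (EuclideanSpace.single i (1:ℝ))) x
    (EuclideanSpace.single i (1:ℝ))

/-- Integral of a function against a signed measure. -/
def sInt (μ : SignedMeasure E2) (f : E2 → ℝ) : ℝ :=
  (∫ x, f x ∂μ.toJordanDecomposition.posPart) - ∫ x, f x ∂μ.toJordanDecomposition.negPart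

/-- Total variation measure of a signed measure. -/
def tv (μ : SignedMeasure E2) : Measure E2 := μ.totalVariation

/-- `u` weakly solves `-Δ u = μ` on `Ω`. -/
def WeakPoisson (Ω : Set E2) (u : E2 → ℝ) (μ : SignedMeasure E2) : Prop :=
  ∀ φ : E2 → ℝ, IsTest φ → tsupport φ ⊆ Ω →
    (∫ x in Ω, u x * lap φ x) = - sInt μ φ

/-- `du` is the weak gradient of `u` on `Ω`. -/
def IsWeakGrad (Ω : Set E2) (u : E2 → ℝ) (du : E2 → E2) : Prop :=
  ∀ φ : E2 → ℝ, IsTest φ → tsupport φ ⊆ Ω → ∀ i : Fin 2,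
    (∫ x in Ω, u x * fderiv ℝ φ x (EuclideanSpace.single i (1:ℝ)))
      = - ∫ x in Ω, φ x * du x i

/-- Piecewise C¹ curve on `[0,1]`. -/
def PiecewiseC1 (γ : ℝ → E2) : Prop :=
  ContinuousOn γ (Set.Icc 0 1) ∧
  ∃ (n : ℕ) (t : Fin (n + 1) → ℝ), StrictMono t ∧ t 0 = 0 ∧ t (Fin.last n) = 1 ∧
    ∀ i : Fin n, ContDiffOn ℝ 1 γ (Set.Icc (t i.castSucc) (t i.succ))

/-- Length of a curve in the conformal metric `e^{2u} g_euc`. -/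
def clen (u : E2 → ℝ) (γ : ℝ → E2) : ℝ :=
  ∫ t in (0:ℝ)..1, Real.exp (u (γ t)) * ‖deriv γ t‖

/-- Piecewise C¹ curves in `Ω` from `x` to `y`. -/
def pathsIn (Ω : Set E2) (x y : E2) : Set (ℝ → E2) :=
  {γ | PiecewiseC1 γ ∧ γ 0 = x ∧ γ 1 = y ∧ ∀ t ∈ Set.Icc (0:ℝ) 1, γ t ∈ Ω}

/-- The distance of the conformal metric `e^{2u} g_euc` on `Ω`. -/
def gdist (u : E2 → ℝ) (Ω : Set E2) (x y : E2) : ℝ :=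
  sInf (clen u '' pathsIn Ω x y)


/-- Real inner product on `E2`. -/
def ip (a b : E2) : ℝ := @inner ℝ E2 _ a b

/-- Partial derivative in the `i`-th coordinate direction. -/
def pd (i : Fin 2) (φ : E2 → ℝ) (x : E2) : ℝ :=
  fderiv ℝ φ x (EuclideanSpace.single i (1:ℝ))

/-- The point with polar coordinates `(r, θ)`. -/
def polarPt (r θ : ℝ) : E2 := !₂[r * Real.cos θ, r * Real.sin θ]

lemma integral_E2_eq_polar (F : E2 → ℝ) :
    ∫ z, F z = ∫ p in Ioi (0:ℝ) ×ˢ Ioo (-Real.pi) Real.pi, p.1 * F (polarPt p.1 p.2) := by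
  have h1 : ∫ z, F z = ∫ p : ℝ × ℝ, F (!₂[p.1, p.2]) := by
    have e1 := (PiLp.volume_preserving_toLp (Fin 2)).integral_comp
      (MeasurableEquiv.toLp 2 (Fin 2 → ℝ)).measurableEmbedding F
    rw [← e1]
    have e2 := (volume_preserving_finTwoArrow ℝ).symm.integral_comp
      (MeasurableEquiv.finTwoArrow (α := ℝ)).symm.measurableEmbedding
      (fun v : Fin 2 → ℝ => F (WithLp.toLp 2 v))
    rw [← e2]
    rfl
  rw [h1, ← integral_comp_polarCoord_symm]
  rfl

lemma continuous_polarPt : Continuous (fun p : ℝ × ℝ => polarPt p.1 p.2) := by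
  unfold polarPt
  fun_prop

@[simp] lemma polarPt_zero (θ : ℝ) : polarPt 0 θ = 0 := by
  ext i; fin_cases i <;> simp [polarPt]

lemma norm_sq_polarPt (r θ : ℝ) : ‖polarPt r θ‖ ^ 2 = r ^ 2 := by
  rw [EuclideanSpace.norm_sq_eq]
  simp [polarPt, Fin.sum_univ_two]
  nlinarith [Real.sin_sq_add_cos_sq θ]

lemma hasDerivAt_polarPt_radius (r θ : ℝ) :
    HasDerivAt (fun s => polarPt s θ)
      (Real.cos θ • EuclideanSpace.single 0 (1:ℝ) + Real.sin θ • EuclideanSpace.single 1 (1:ℝ)) r := by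
  have h : HasDerivAt (fun s : ℝ => s • polarPt 1 θ) (polarPt 1 θ) r := by
    simpa using (hasDerivAt_id r).smul_const (polarPt 1 θ)
  convert h using 1
  · funext s
    ext i; fin_cases i <;> simp [polarPt]
  · ext i; fin_cases i <;> simp [polarPt]

lemma hasDerivAt_polarPt_angle (r θ : ℝ) :
    HasDerivAt (fun t => polarPt r t)
      (-(r * Real.sin θ) • EuclideanSpace.single 0 (1:ℝ) +
        (r * Real.cos θ) • EuclideanSpace.single 1 (1:ℝ)) θ := by
  have h : HasDerivAt (fun t : ℝ => (r * Real.cos t) • EuclideanSpace.single (0 : Fin 2) (1:ℝ) +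
      (r * Real.sin t) • EuclideanSpace.single (1 : Fin 2) (1:ℝ))
      (-(r * Real.sin θ) • EuclideanSpace.single 0 (1:ℝ) +
        (r * Real.cos θ) • EuclideanSpace.single 1 (1:ℝ)) θ := by
    have := (((Real.hasDerivAt_cos θ).const_mul r).smul_const
      (EuclideanSpace.single (0 : Fin 2) (1:ℝ))).add
      (((Real.hasDerivAt_sin θ).const_mul r).smul_const (EuclideanSpace.single (1 : Fin 2) (1:ℝ)))
    exact this.congr_deriv (by simp)
  convert h using 1
  funext s
  ext i; fin_cases i <;> simp [polarPt]

lemma hasDerivAt_comp_polarPt_radius {φ : E2 → ℝ} (hφ : Differentiable ℝ φ) (r θ : ℝ) :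
    HasDerivAt (fun s => φ (polarPt s θ))
      (Real.cos θ * pd 0 φ (polarPt r θ) + Real.sin θ * pd 1 φ (polarPt r θ)) r := by
  have := (hφ (polarPt r θ)).hasFDerivAt.comp_hasDerivAt r (hasDerivAt_polarPt_radius r θ)
  exact this.congr_deriv (by simp [pd, map_add, map_smul])

lemma hasDerivAt_comp_polarPt_angle {φ : E2 → ℝ} (hφ : Differentiable ℝ φ) (r θ : ℝ) :
    HasDerivAt (fun t => φ (polarPt r t))
      (-(r * Real.sin θ) * pd 0 φ (polarPt r θ) + r * Real.cos θ * pd 1 φ (polarPt r θ)) θ := by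
  have := (hφ (polarPt r θ)).hasFDerivAt.comp_hasDerivAt θ (hasDerivAt_polarPt_angle r θ)
  exact this.congr_deriv (by simp [pd, map_add, map_smul])

/-- Smooth cutoff in the squared radius, equal to `1` near `0` and vanishing for `δ ^ 2 ≤ s`. -/
def cutoff (δ s : ℝ) : ℝ := Real.smoothTransition (2 - 2 * s / δ ^ 2)

lemma contDiff_cutoff (δ : ℝ) : ContDiff ℝ (⊤ : ℕ∞) (cutoff δ) := by
  unfold cutoff
  exact Real.smoothTransition.contDiff.comp (by fun_prop)

lemma cutoff_zero (δ : ℝ) : cutoff δ 0 = 1 := by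
  unfold cutoff
  exact Real.smoothTransition.one_of_one_le (by norm_num)

lemma cutoff_eq_zero {δ s : ℝ} (hδ : 0 < δ) (hs : δ ^ 2 ≤ s) : cutoff δ s = 0 := by
  unfold cutoff
  apply Real.smoothTransition.zero_of_nonpos
  have : 1 ≤ s / δ ^ 2 := by rw [le_div_iff₀ (by positivity)]; linarith
  rw [mul_div_assoc]; linarith

lemma abs_cutoff_le (δ s : ℝ) : |cutoff δ s| ≤ 1 := by
  unfold cutoff
  rw [abs_of_nonneg (Real.smoothTransition.nonneg _)]
  exact Real.smoothTransition.le_one _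

lemma deriv_cutoff_eq_zero {δ s : ℝ} (hδ : 0 < δ) (hs : δ ^ 2 < s) : deriv (cutoff δ) s = 0 := by
  have : cutoff δ =ᶠ[𝓝 s] fun _ => 0 := by
    filter_upwards [lt_mem_nhds hs] with t ht using cutoff_eq_zero hδ ht.le
  rw [this.deriv_eq]; simp

/-- Truncated gradient of the logarithmic potential. -/
def gradKer (δ : ℝ) (i : Fin 2) (z : E2) : ℝ :=
  (2 * Real.pi)⁻¹ * (cutoff δ (‖z‖ ^ 2) * (z i / ‖z‖ ^ 2))

/-- Smooth error kernel created by the truncation in `gradKer`. -/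
def remKer (δ : ℝ) (z : E2) : ℝ := -(Real.pi⁻¹ * deriv (cutoff δ) (‖z‖ ^ 2))

lemma gradKer_eq_zero {δ : ℝ} (hδ : 0 < δ) (i : Fin 2) {z : E2} (hz : δ ≤ ‖z‖) :
    gradKer δ i z = 0 := by
  unfold gradKer
  rw [cutoff_eq_zero hδ (by gcongr)]; simp

lemma remKer_eq_zero {δ : ℝ} (hδ : 0 < δ) {z : E2} (hz : δ < ‖z‖) : remKer δ z = 0 := by
  unfold remKer
  rw [deriv_cutoff_eq_zero hδ (by gcongr)]; simp

lemma contDiff_remKer (δ : ℝ) : ContDiff ℝ (⊤ : ℕ∞) (remKer δ) := by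
  unfold remKer
  have h : ContDiff ℝ (⊤ : ℕ∞) (deriv (cutoff δ)) :=
    ((contDiff_infty_iff_deriv).1 (contDiff_cutoff δ)).2
  exact (contDiff_const.mul (h.comp (contDiff_norm_sq ℝ))).neg

lemma isTest_remKer {δ : ℝ} (hδ : 0 < δ) : IsTest (remKer δ) :=
  ⟨contDiff_remKer δ, HasCompactSupport.intro (isCompact_closedBall (0:E2) δ) fun z hz =>
    remKer_eq_zero hδ (by simpa using hz)⟩

lemma measurable_gradKer (δ : ℝ) (i : Fin 2) : Measurable (gradKer δ i) := by
  unfold gradKer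
  have := (contDiff_cutoff δ).continuous.measurable
  fun_prop

lemma abs_gradKer_le {δ : ℝ} (hδ : 0 < δ) (i : Fin 2) (z : E2) :
    |gradKer δ i z| ≤ indicator (Iio δ) (fun r => r⁻¹) ‖z‖ := by
  by_cases hz : ‖z‖ < δ
  · rw [indicator_of_mem (by simpa using hz)]
    rcases eq_or_ne z 0 with rfl | h0
    · simp [gradKer]
    have hn : 0 < ‖z‖ := norm_pos_iff.2 h0
    unfold gradKer
    rw [abs_mul, abs_mul, abs_div, abs_of_pos (a := ‖z‖ ^ 2) (by positivity)]
    have h1 : |(2 * Real.pi)⁻¹| ≤ 1 := by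
      rw [abs_of_pos (by positivity)]
      exact inv_le_one_of_one_le₀ (by linarith [Real.pi_gt_three])
    have h2 : |z i| / ‖z‖ ^ 2 ≤ ‖z‖⁻¹ := by
      rw [div_le_iff₀ (by positivity)]
      have : |z i| ≤ ‖z‖ := by simpa using PiLp.norm_apply_le z i
      calc |z i| ≤ ‖z‖ := this
        _ = ‖z‖⁻¹ * ‖z‖ ^ 2 := by field_simp
    calc _ ≤ 1 * (1 * ‖z‖⁻¹) := by
          gcongr
          exact abs_cutoff_le _ _
      _ = _ := by ring
  · rw [gradKer_eq_zero hδ i (not_lt.1 hz)]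
    simp [indicator, hz]

lemma memLp_gradKer {δ : ℝ} (hδ : 0 < δ) (i : Fin 2) {q : ℝ} (hq1 : 1 ≤ q) (hq2 : q < 2) :
    MemLp (gradKer δ i) (ENNReal.ofReal q) := by
  have hq0 : 0 < q := by linarith
  have key : Integrable (fun z : E2 => indicator (Iio δ) (fun r : ℝ => r ^ (-q)) ‖z‖) := by
    rw [integrable_fun_norm_addHaar volume (f := indicator (Iio δ) (fun r : ℝ => r ^ (-q)))]
    have h : IntegrableOn (fun r : ℝ => r ^ (1 - q)) (Ioo 0 δ) :=
      (intervalIntegral.integrableOn_Ioo_rpow_iff hδ).2 (by linarith)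
    have h' := (integrableOn_indicator_iff (μ := volume) (s := Iio δ) (t := Ioi 0)
      (f := fun r : ℝ => r ^ (1 - q)) measurableSet_Iio).2
      (by simpa [Iio_inter_Ioi, inter_comm] using h)
    refine h'.congr_fun (fun r hr => ?_) measurableSet_Ioi
    have hr : 0 < r := hr
    by_cases hrδ : r < δ
    · simp only [indicator, mem_Iio, hrδ, if_true, finrank_euclideanSpace, Fintype.card_fin,
        smul_eq_mul]
      norm_num
      rw [sub_eq_add_neg, Real.rpow_add hr, Real.rpow_one]
    · simp [indicator, hrδ]
  refine (integrable_norm_rpow_iff (measurable_gradKer δ i).aestronglyMeasurable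
    (by simpa using hq0) (by simp)).1 ?_
  rw [ENNReal.toReal_ofReal hq0.le]
  refine key.mono' (((measurable_gradKer δ i).norm.pow_const q).aestronglyMeasurable)
    (Eventually.of_forall fun z => ?_)
  rw [Real.norm_eq_abs, abs_of_nonneg (by positivity), Real.norm_eq_abs]
  refine (Real.rpow_le_rpow (abs_nonneg _) (abs_gradKer_le hδ i z) hq0.le).trans ?_
  by_cases h : ‖z‖ < δ
  · simp only [indicator, mem_Iio, h, if_true]
    rw [Real.rpow_neg (norm_nonneg _), Real.inv_rpow (norm_nonneg _)]
  · simp [indicator, h, Real.zero_rpow hq0.ne']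

lemma IsTest.differentiable {φ : E2 → ℝ} (h : IsTest φ) : Differentiable ℝ φ :=
  h.1.differentiable (by simp)

lemma IsTest.continuous {φ : E2 → ℝ} (h : IsTest φ) : Continuous φ := h.1.continuous

lemma IsTest.integrable {φ : E2 → ℝ} (h : IsTest φ) : Integrable φ :=
  h.continuous.integrable_of_hasCompactSupport h.2

lemma IsTest.pd {φ : E2 → ℝ} (h : IsTest φ) (i : Fin 2) : IsTest (pd i φ) := by
  refine ⟨?_, h.2.fderiv_apply ℝ _⟩
  have h1 : ContDiff ℝ (⊤ : ℕ∞) (fderiv ℝ φ) := h.1.fderiv_right (by simp)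
  exact h1.clm_apply contDiff_const

lemma lap_eq_sum_pd (φ : E2 → ℝ) (x : E2) : lap φ x = ∑ i, pd i (pd i φ) x := rfl

lemma pd_comm {φ : E2 → ℝ} (h : IsTest φ) (i j : Fin 2) : pd i (pd j φ) = pd j (pd i φ) := by
  funext x
  have hs : IsSymmSndFDerivAt ℝ φ x :=
    h.1.contDiffAt.isSymmSndFDerivAt (by
      rw [minSmoothness_of_isRCLikeNormedField]
      exact WithTop.coe_le_coe.2 (le_top : (2 : ℕ∞) ≤ ⊤))
  have h1 : DifferentiableAt ℝ (fderiv ℝ φ) x :=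
    ((h.1.fderiv_right (m := (⊤ : ℕ∞)) (by simp)).differentiable (by simp)) x
  have key : ∀ i j : Fin 2, _root_.pd i (_root_.pd j φ) x = fderiv ℝ (fderiv ℝ φ) x
      (EuclideanSpace.single i (1:ℝ)) (EuclideanSpace.single j (1:ℝ)) := by
    intro i j
    have := (h1.hasFDerivAt.clm_apply
      (hasFDerivAt_const (EuclideanSpace.single j (1:ℝ)) x)).fderiv
    unfold _root_.pd
    rw [this]
    simp
  rw [key, key, hs]

/-- Integration in polar coordinates of a compactly supported continuous polar density. -/
lemma integral_E2_eq_iterated_polar {F : E2 → ℝ} {G : ℝ × ℝ → ℝ} {R : ℝ}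
    (hG : Continuous G)
    (hR : ∀ r θ, R < r → G (r, θ) = 0)
    (hFG : ∀ r θ, 0 < r → r * F (polarPt r θ) = G (r, θ)) :
    IntegrableOn G (Ioi (0:ℝ) ×ˢ Ioo (-Real.pi) Real.pi) ∧
    ∫ z, F z = ∫ r in Ioi (0:ℝ), ∫ θ in Ioo (-Real.pi) Real.pi, G (r, θ) := by
  have h1 : IntegrableOn G (Icc 0 R ×ˢ Icc (-Real.pi) Real.pi) :=
    hG.continuousOn.integrableOn_compact (isCompact_Icc.prod isCompact_Icc)
  have h2 : IntegrableOn G (Ioi (0:ℝ) ×ˢ Ioo (-Real.pi) Real.pi) := by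
    refine h1.of_forall_sdiff_eq_zero (measurableSet_Ioi.prod measurableSet_Ioo) ?_
    rintro ⟨r, θ⟩ ⟨⟨hr, hθ⟩, hn⟩
    refine hR _ _ ?_
    by_contra hc
    exact hn ⟨⟨le_of_lt hr, not_lt.1 hc⟩, ⟨hθ.1.le, hθ.2.le⟩⟩
  refine ⟨h2, ?_⟩
  rw [integral_E2_eq_polar, ← setIntegral_prod _ h2]
  exact setIntegral_congr_fun (measurableSet_Ioi.prod measurableSet_Ioo) fun p hp => hFG _ _ hp.1

lemma integrable_mul_of_bdd {κ : E2 → ℝ} (hκ : Integrable κ) {φ : E2 → ℝ} (hφ : IsTest φ) :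
    Integrable (fun z => κ z * φ z) := by
  obtain ⟨C, hC⟩ := hφ.continuous.bounded_above_of_compact_support hφ.2
  exact hκ.mul_bdd (c := C) hφ.continuous.aestronglyMeasurable (Eventually.of_forall hC)

lemma integrable_gradKer {δ : ℝ} (hδ : 0 < δ) (i : Fin 2) : Integrable (gradKer δ i) := by
  have := memLp_gradKer hδ i le_rfl one_lt_two
  simpa [memLp_one_iff_integrable] using this

theorem integral_gradKer_mul_pd {δ : ℝ} (hδ : 0 < δ) {φ : E2 → ℝ} (hφ : IsTest φ) :
    ∑ j, ∫ z, gradKer δ j z * pd j φ z = -φ 0 + ∫ z, remKer δ z * φ z := by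
  have i1 : ∀ j ∈ (Finset.univ : Finset (Fin 2)), Integrable (fun z => gradKer δ j z * pd j φ z) :=
    fun j _ => integrable_mul_of_bdd (integrable_gradKer hδ j) (hφ.pd j)
  have i2 : Integrable (fun z => remKer δ z * φ z) :=
    integrable_mul_of_bdd (isTest_remKer hδ).integrable hφ
  rw [← integral_finsetSum _ i1]
  suffices h : ∫ z, ((∑ j, gradKer δ j z * pd j φ z) - remKer δ z * φ z) = -φ 0 by
    rw [integral_sub (integrable_finsetSum _ i1) i2] at h
    linarith
  let g : ℝ → ℝ → ℝ := fun θ r => cutoff δ (r ^ 2) * φ (polarPt r θ)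
  let G : ℝ × ℝ → ℝ := fun p => (2 * Real.pi)⁻¹ *
    (2 * p.1 * deriv (cutoff δ) (p.1 ^ 2) * φ (polarPt p.1 p.2) + cutoff δ (p.1 ^ 2) *
      (Real.cos p.2 * pd 0 φ (polarPt p.1 p.2) + Real.sin p.2 * pd 1 φ (polarPt p.1 p.2)))
  have hdc : ContDiff ℝ (⊤ : ℕ∞) (deriv (cutoff δ)) :=
    ((contDiff_infty_iff_deriv).1 (contDiff_cutoff δ)).2
  have hGc : Continuous G := by
    have c0 := continuous_polarPt
    have c1 := hφ.continuous.comp c0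
    have c2 := (hφ.pd 0).continuous.comp c0
    have c3 := (hφ.pd 1).continuous.comp c0
    have c4 : Continuous fun p : ℝ × ℝ => deriv (cutoff δ) (p.1 ^ 2) :=
      hdc.continuous.comp (by fun_prop)
    have c5 : Continuous fun p : ℝ × ℝ => cutoff δ (p.1 ^ 2) :=
      (contDiff_cutoff δ).continuous.comp (by fun_prop)
    exact continuous_const.mul ((((continuous_const.mul continuous_fst).mul c4).mul c1).add
      (c5.mul (((Real.continuous_cos.comp continuous_snd).mul c2).add
        ((Real.continuous_sin.comp continuous_snd).mul c3))))
  have hg : ∀ θ r, HasDerivAt (g θ) (2 * Real.pi * G (r, θ)) r := by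
    intro θ r
    have e1 : HasDerivAt (fun r : ℝ => cutoff δ (r ^ 2)) (deriv (cutoff δ) (r ^ 2) * (2 * r)) r := by
      have := ((contDiff_cutoff δ).differentiable (by simp) (r ^ 2)).hasDerivAt.comp r
        (hasDerivAt_pow 2 r)
      exact this.congr_deriv (by simp)
    refine (e1.mul (hasDerivAt_comp_polarPt_radius hφ.differentiable r θ)).congr_deriv ?_
    simp only [G]
    field_simp
  have hG0 : ∀ r θ, δ < r → G (r, θ) = 0 := by
    intro r θ hr
    have : δ ^ 2 < r ^ 2 := by gcongr
    simp [G, cutoff_eq_zero hδ this.le, deriv_cutoff_eq_zero hδ this]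
  obtain ⟨hint, heq⟩ := integral_E2_eq_iterated_polar
    (F := fun z => (∑ j, gradKer δ j z * pd j φ z) - remKer δ z * φ z) (G := G) (R := δ)
    hGc hG0 (by
      intro r θ hr
      simp only [Fin.sum_univ_two, gradKer, remKer, norm_sq_polarPt, G]
      simp only [polarPt, PiLp.toLp_apply, Matrix.cons_val_zero, Matrix.cons_val_one]
      field_simp
      ring)
  rw [heq, integral_integral_swap]
  swap
  · rw [Measure.prod_restrict]; exact hint
  have hin : ∀ θ, ∫ r in Ioi (0:ℝ), G (r, θ) = -((2 * Real.pi)⁻¹ * φ 0) := by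
    intro θ
    have hgs : ContDiff ℝ 1 (g θ) := by
      refine contDiff_one_iff_deriv.2 ⟨fun r => (hg θ r).differentiableAt, ?_⟩
      have : deriv (g θ) = fun r => 2 * Real.pi * G (r, θ) := funext fun r => (hg θ r).deriv
      rw [this]
      fun_prop
    have hcs : HasCompactSupport (g θ) := by
      refine HasCompactSupport.intro (isCompact_Icc (a := -δ) (b := δ)) fun r hr => ?_
      have : δ ≤ |r| := by
        by_contra hc
        exact hr (abs_le.1 (not_le.1 hc).le)
      have : δ ^ 2 ≤ r ^ 2 := by rw [← sq_abs r]; gcongr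
      simp [g, cutoff_eq_zero hδ this]
    have := hcs.integral_Ioi_deriv_eq hgs 0
    simp only [fun r => (hg θ r).deriv, integral_const_mul] at this
    simp [g, cutoff_zero] at this
    field_simp
    linarith
  simp only [hin]
  simp
  rw [max_eq_left (by positivity)]
  field_simp
  norm_num

theorem integral_gradKer_mul_pd_comm {δ : ℝ} (hδ : 0 < δ) {φ : E2 → ℝ} (hφ : IsTest φ)
    (i j : Fin 2) :
    ∫ z, gradKer δ i z * pd j φ z = ∫ z, gradKer δ j z * pd i φ z := by
  suffices h : ∫ z, gradKer δ 0 z * pd 1 φ z = ∫ z, gradKer δ 1 z * pd 0 φ z by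
    fin_cases i <;> fin_cases j
    · rfl
    · exact h
    · exact h.symm
    · rfl
  rw [← sub_eq_zero, ← integral_sub
    (integrable_mul_of_bdd (integrable_gradKer hδ 0) (hφ.pd 1))
    (integrable_mul_of_bdd (integrable_gradKer hδ 1) (hφ.pd 0))]
  let G : ℝ × ℝ → ℝ := fun p => (2 * Real.pi)⁻¹ * (cutoff δ (p.1 ^ 2) *
    (Real.cos p.2 * pd 1 φ (polarPt p.1 p.2) - Real.sin p.2 * pd 0 φ (polarPt p.1 p.2)))
  have hGc : Continuous G := by
    have c0 := continuous_polarPt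
    have c2 := (hφ.pd 0).continuous.comp c0
    have c3 := (hφ.pd 1).continuous.comp c0
    have c5 : Continuous fun p : ℝ × ℝ => cutoff δ (p.1 ^ 2) :=
      (contDiff_cutoff δ).continuous.comp (by fun_prop)
    simp only [Function.comp_def] at c2 c3
    simp only [G]
    fun_prop
  have hG0 : ∀ r θ, δ < r → G (r, θ) = 0 := by
    intro r θ hr
    have : δ ^ 2 < r ^ 2 := by gcongr
    simp [G, cutoff_eq_zero hδ this.le]
  obtain ⟨-, heq⟩ := integral_E2_eq_iterated_polar
    (F := fun z => gradKer δ 0 z * pd 1 φ z - gradKer δ 1 z * pd 0 φ z) (G := G) (R := δ)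
    hGc hG0 (by
      intro r θ hr
      simp only [gradKer, norm_sq_polarPt, G]
      simp only [polarPt, PiLp.toLp_apply, Matrix.cons_val_zero, Matrix.cons_val_one]
      field_simp)
  rw [heq]
  refine (setIntegral_congr_fun measurableSet_Ioi fun r hr => ?_).trans (integral_zero _ _)
  have hr : 0 < r := hr
  have hd : ∀ θ, HasDerivAt (fun t => (2 * Real.pi)⁻¹ * (cutoff δ (r ^ 2) * r⁻¹) * φ (polarPt r t))
      (G (r, θ)) θ := by
    intro θ
    refine ((hasDerivAt_comp_polarPt_angle hφ.differentiable r θ).const_mul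
      ((2 * Real.pi)⁻¹ * (cutoff δ (r ^ 2) * r⁻¹))).congr_deriv ?_
    simp only [G]
    field_simp
    ring
  have hle : -Real.pi ≤ Real.pi := by linarith [Real.pi_pos]
  show ∫ θ in Ioo (-Real.pi) Real.pi, G (r, θ) = 0
  rw [← integral_Ioc_eq_integral_Ioo, ← intervalIntegral.integral_of_le hle,
    intervalIntegral.integral_eq_sub_of_hasDerivAt (fun θ _ => hd θ)
      ((by fun_prop : Continuous fun θ => G (r, θ)).intervalIntegrable _ _)]
  simp [polarPt]

/-- Convolution of a kernel with a function on the plane. -/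
def planeConv (κ φ : E2 → ℝ) (y : E2) : ℝ := ∫ z, κ z * φ (y - z)

lemma planeConv_eq_convolution (κ φ : E2 → ℝ) :
    planeConv κ φ = convolution κ φ (ContinuousLinearMap.mul ℝ ℝ) volume := rfl

lemma planeConv_eq_integral_sub (κ φ : E2 → ℝ) (y : E2) :
    planeConv κ φ y = ∫ x, κ (y - x) * φ x := by
  rw [planeConv, ← integral_sub_left_eq_self (fun z => κ z * φ (y - z)) volume y]
  simp

lemma planeConv_comm (κ φ : E2 → ℝ) : planeConv κ φ = planeConv φ κ := by
  funext y
  rw [planeConv_eq_integral_sub, planeConv]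
  simp only [mul_comm]

lemma pd_planeConv {κ φ : E2 → ℝ} (hκ : Integrable κ) (hφ : IsTest φ) (i : Fin 2) :
    pd i (planeConv κ φ) = planeConv κ (pd i φ) := by
  funext x
  have h1 : ContDiff ℝ 1 φ := hφ.1.of_le (by exact_mod_cast le_top)
  have h := hφ.2.hasFDerivAt_convolution_right (ContinuousLinearMap.mul ℝ ℝ)
    hκ.locallyIntegrable h1 x
  rw [pd, planeConv_eq_convolution, h.fderiv, convolution_precompR_apply _ hκ.locallyIntegrable
    (hφ.2.fderiv ℝ) (h1.continuous_fderiv (by simp))]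
  rfl

lemma planeConv_pd_eq {κ φ : E2 → ℝ} (hκ : IsTest κ) (hφ : IsTest φ) (i : Fin 2) :
    planeConv κ (pd i φ) = planeConv (pd i κ) φ := by
  rw [← pd_planeConv hκ.integrable hφ, planeConv_comm κ φ, pd_planeConv hφ.integrable hκ,
    planeConv_comm]

lemma planeConv_eq_zero {κ φ : E2 → ℝ} {δ R : ℝ} (hκ : ∀ z, δ < ‖z‖ → κ z = 0)
    (hφ : tsupport φ ⊆ closedBall 0 R) {y : E2} (hy : R + δ < ‖y‖) : planeConv κ φ y = 0 := by
  refine (integral_congr_ae (Eventually.of_forall fun z => ?_)).trans (integral_zero _ _)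
  rcases lt_or_ge δ ‖z‖ with hz | hz
  · simp [hκ z hz]
  · have : φ (y - z) = 0 := by
      by_contra hne
      have := hφ (subset_tsupport _ hne)
      rw [mem_closedBall_zero_iff] at this
      have h2 := norm_sub_norm_le y z
      linarith
    simp [this]

lemma tsupport_planeConv_subset {κ φ : E2 → ℝ} {δ R : ℝ} (hκ : ∀ z, δ < ‖z‖ → κ z = 0)
    (hφ : tsupport φ ⊆ closedBall 0 R) : tsupport (planeConv κ φ) ⊆ closedBall 0 (R + δ) := by
  refine closure_minimal (fun y hy => ?_) isClosed_closedBall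
  by_contra hc
  exact hy (planeConv_eq_zero hκ hφ (by simpa using hc))

lemma exists_tsupport_subset_closedBall {φ : E2 → ℝ} {ρ : ℝ}
    (hs : tsupport φ ⊆ ball 0 ρ) : ∃ R < ρ, tsupport φ ⊆ closedBall 0 R := by
  obtain ⟨R, hR, h⟩ := exists_lt_subset_ball (isClosed_tsupport φ) hs
  exact ⟨R, hR, h.trans ball_subset_closedBall⟩

lemma tsupport_planeConv_subset_ball {κ φ : E2 → ℝ} {δ ρ : ℝ} (hκ : ∀ z, δ < ‖z‖ → κ z = 0)
    (hs : tsupport φ ⊆ ball 0 ρ) :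
    tsupport (planeConv κ φ) ⊆ ball 0 (ρ + δ) := by
  obtain ⟨R, hR, h⟩ := exists_tsupport_subset_closedBall hs
  exact (tsupport_planeConv_subset hκ h).trans (closedBall_subset_ball (by linarith))

lemma IsTest.planeConv {κ φ : E2 → ℝ} {δ : ℝ} (hi : Integrable κ) (hκ : ∀ z, δ < ‖z‖ → κ z = 0)
    (hφ : IsTest φ) : IsTest (planeConv κ φ) := by
  refine ⟨hφ.2.contDiff_convolution_right (n := ⊤) (ContinuousLinearMap.mul ℝ ℝ)
    hi.locallyIntegrable hφ.1, ?_⟩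
  obtain ⟨R, hR⟩ := hφ.2.isCompact.isBounded.subset_closedBall (0 : E2)
  exact HasCompactSupport.intro (isCompact_closedBall (0:E2) (R + δ)) fun y hy =>
    planeConv_eq_zero hκ hR (by simpa using hy)

lemma isTest_reflect {φ : E2 → ℝ} (hφ : IsTest φ) (y : E2) : IsTest (fun z => φ (y - z)) :=
  ⟨hφ.1.comp (contDiff_const.sub contDiff_id),
    hφ.2.comp_homeomorph (Homeomorph.subLeft y)⟩

lemma pd_reflect {φ : E2 → ℝ} (hφ : IsTest φ) (y z : E2) (i : Fin 2) :
    pd i (fun z => φ (y - z)) z = -pd i φ (y - z) := by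
  have h := (hφ.differentiable (y - z)).hasFDerivAt.comp z
    ((hasFDerivAt_const y z).sub (hasFDerivAt_id z))
  have h' : HasFDerivAt (fun z => φ (y - z)) _ z := h
  rw [pd, h'.fderiv]
  simp [pd]

lemma sum_planeConv_gradKer_pd {δ : ℝ} (hδ : 0 < δ) {φ : E2 → ℝ} (hφ : IsTest φ) (y : E2) :
    ∑ j, planeConv (gradKer δ j) (pd j φ) y = φ y - planeConv (remKer δ) φ y := by
  have h := integral_gradKer_mul_pd hδ (isTest_reflect hφ y)
  simp only [pd_reflect hφ, mul_neg, integral_neg, Finset.sum_neg_distrib, sub_zero] at h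
  simp only [planeConv]
  linarith

lemma planeConv_gradKer_pd_comm {δ : ℝ} (hδ : 0 < δ) {φ : E2 → ℝ} (hφ : IsTest φ)
    (i j : Fin 2) :
    planeConv (gradKer δ i) (pd j φ) = planeConv (gradKer δ j) (pd i φ) := by
  funext y
  have h := integral_gradKer_mul_pd_comm hδ (isTest_reflect hφ y) i j
  simp only [pd_reflect hφ, mul_neg, integral_neg] at h
  exact neg_injective h

lemma lap_planeConv_gradKer {δ : ℝ} (hδ : 0 < δ) {φ : E2 → ℝ} (hφ : IsTest φ) (i : Fin 2)
    (y : E2) : lap (planeConv (gradKer δ i) φ) y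
      = pd i φ y - planeConv (pd i (remKer δ)) φ y := by
  rw [lap_eq_sum_pd]
  have : ∀ j, pd j (pd j (planeConv (gradKer δ i) φ)) = planeConv (gradKer δ j) (pd j (pd i φ)) := by
    intro j
    rw [pd_planeConv (integrable_gradKer hδ i) hφ, pd_planeConv (integrable_gradKer hδ i) (hφ.pd j),
      planeConv_gradKer_pd_comm hδ (hφ.pd j), pd_comm hφ]
  simp only [this]
  rw [sum_planeConv_gradKer_pd hδ (hφ.pd i), planeConv_pd_eq (isTest_remKer hδ) hφ]

/-- Potential of the measure `w ν` with respect to the kernel `κ`. -/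
def pot (κ w : E2 → ℝ) (ν : Measure E2) (x : E2) : ℝ := ∫ y, w y * κ (y - x) ∂ν

section pot

variable {κ w : E2 → ℝ} {ν : Measure E2} [SFinite ν]

lemma integrable_pot_kernel (hκ : Integrable κ) (hw : Integrable w ν) :
    Integrable (fun p : E2 × E2 => w p.2 * κ (p.2 - p.1)) (volume.prod ν) := by
  have := hw.convolution_integrand (μ := volume) (ContinuousLinearMap.mul ℝ ℝ) hκ.comp_neg
  simpa using this

lemma integrable_pot (hκ : Integrable κ) (hw : Integrable w ν) : Integrable (pot κ w ν) :=
  (integrable_pot_kernel hκ hw).integral_prod_left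

lemma integral_mul_pot (hκ : Integrable κ) (hw : Integrable w ν) {φ : E2 → ℝ} (hφ : IsTest φ) :
    ∫ x, φ x * pot κ w ν x = ∫ y, w y * planeConv κ φ y ∂ν := by
  obtain ⟨C, hC⟩ := hφ.continuous.bounded_above_of_compact_support hφ.2
  have hI : Integrable (fun p : E2 × E2 => φ p.1 * (w p.2 * κ (p.2 - p.1))) (volume.prod ν) :=
    (integrable_pot_kernel hκ hw).bdd_mul (c := C)
      (hφ.continuous.comp continuous_fst).aestronglyMeasurable (Eventually.of_forall fun p => hC _)
  have := integral_integral_swap (f := fun x y => φ x * (w y * κ (y - x))) hI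
  simp only [integral_const_mul] at this
  refine this.trans (integral_congr_ae (Eventually.of_forall fun y => ?_))
  simp only [planeConv_eq_integral_sub, ← integral_const_mul]
  exact integral_congr_ae (Eventually.of_forall fun x => by ring)

lemma eLpNorm_pot_le (hκm : Measurable κ) (hw : Integrable w ν) {q : ℝ}
    (hq : 1 ≤ q) :
    eLpNorm (pot κ w ν) (ENNReal.ofReal q) volume
      ≤ eLpNorm κ (ENNReal.ofReal q) volume * ∫⁻ y, ‖w y‖ₑ ∂ν := by
  have hq0 : 0 < q := by linarith
  have hqne : ENNReal.ofReal q ≠ 0 := by simpa using hq0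
  have hwm : AEMeasurable (fun y => ‖w y‖ₑ) ν := hw.aestronglyMeasurable.enorm
  set A : ℝ≥0∞ := ∫⁻ y, ‖w y‖ₑ ∂ν with hA
  have hAtop : A ≠ ∞ := hw.2.ne
  set ν' := ν.withDensity (fun y => ‖w y‖ₑ) with hν'
  have hν'univ : ν' univ = A := by simp [hν', hA]
  have hshift : ∀ x : E2, Measurable fun y => κ (y - x) := fun x => hκm.comp (measurable_sub_const x)
  have hpt : ∀ x, ‖pot κ w ν x‖ₑ ^ q ≤ (∫⁻ y, ‖κ (y - x)‖ₑ ^ q ∂ν') * A ^ (q - 1) := by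
    intro x
    have h1 : ‖pot κ w ν x‖ₑ ≤ eLpNorm (fun y => κ (y - x)) 1 ν' := by
      rw [eLpNorm_one_eq_lintegral_enorm, hν',
        lintegral_withDensity_eq_lintegral_mul₀ hwm (hshift x).enorm.aemeasurable]
      refine (enorm_integral_le_lintegral_enorm _).trans (le_of_eq ?_)
      simp [enorm_mul]
    have h2 := eLpNorm_le_eLpNorm_mul_rpow_measure_univ (μ := ν') (f := fun y => κ (y - x))
      (p := 1) (q := ENNReal.ofReal q) (by simpa using hq) (hshift x).aestronglyMeasurable
    have h3 := h1.trans h2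
    rw [hν'univ, eLpNorm_eq_lintegral_rpow_enorm_toReal hqne (by simp),
      ENNReal.toReal_ofReal hq0.le] at h3
    refine (ENNReal.rpow_le_rpow h3 hq0.le).trans (le_of_eq ?_)
    rw [ENNReal.mul_rpow_of_nonneg _ _ hq0.le, ← ENNReal.rpow_mul, ← ENNReal.rpow_mul,
      one_div, inv_mul_cancel₀ hq0.ne', ENNReal.rpow_one]
    congr 2
    simp
    field_simp
  have hswap : ∫⁻ x, ∫⁻ y, ‖κ (y - x)‖ₑ ^ q ∂ν' = A * ∫⁻ z, ‖κ z‖ₑ ^ q := by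
    rw [lintegral_lintegral_swap (by
      have : Measurable fun p : E2 × E2 => κ (p.2 - p.1) :=
        hκm.comp (measurable_snd.sub measurable_fst)
      exact (this.enorm.pow_const q).aemeasurable)]
    have : ∀ y, ∫⁻ x, ‖κ (y - x)‖ₑ ^ q = ∫⁻ z, ‖κ z‖ₑ ^ q := fun y =>
      lintegral_sub_left_eq_self (fun z => ‖κ z‖ₑ ^ q) y
    simp only [this, lintegral_const, hν'univ, mul_comm]
  rw [eLpNorm_eq_lintegral_rpow_enorm_toReal hqne (by simp),
    eLpNorm_eq_lintegral_rpow_enorm_toReal hqne (by simp), ENNReal.toReal_ofReal hq0.le]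
  calc (∫⁻ x, ‖pot κ w ν x‖ₑ ^ q) ^ (1 / q)
      ≤ ((∫⁻ z, ‖κ z‖ₑ ^ q) * A ^ q) ^ (1 / q) := by
        gcongr
        refine (lintegral_mono hpt).trans ?_
        rw [lintegral_mul_const' _ _ (ENNReal.rpow_ne_top_of_nonneg (by linarith) hAtop), hswap,
          mul_comm A, mul_assoc]
        gcongr
        nth_rw 1 [← ENNReal.rpow_one A]
        rw [← ENNReal.rpow_add_of_nonneg _ _ zero_le_one (by linarith)]
        simp
    _ = _ := by
        rw [ENNReal.mul_rpow_of_nonneg _ _ (by positivity), ← ENNReal.rpow_mul (x := A),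
          mul_one_div_cancel hq0.ne', ENNReal.rpow_one]

end pot

lemma setIntegral_eq_of_tsupport_subset {ν : Measure E2} {S : Set E2} {φ f : E2 → ℝ}
    (hs : tsupport φ ⊆ S) (hf : ∀ x, φ x = 0 → f x = 0) : ∫ x in S, f x ∂ν = ∫ x, f x ∂ν := by
  refine setIntegral_eq_integral_of_forall_compl_eq_zero fun x hx => hf x ?_
  by_contra hne
  exact hx (hs (subset_tsupport _ hne))

/-- The fundamental lemma of the calculus of variations on a ball. -/
lemma ae_eq_of_integral_test_eq {r : ℝ} {f g : E2 → ℝ} (hf : IntegrableOn f (ball 0 r))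
    (hg : IntegrableOn g (ball 0 r))
    (h : ∀ φ, IsTest φ → tsupport φ ⊆ ball 0 r →
      ∫ x in ball 0 r, φ x * f x = ∫ x in ball 0 r, φ x * g x) :
    f =ᵐ[volume.restrict (ball 0 r)] g := by
  have key := isOpen_ball.ae_eq_zero_of_integral_contDiff_smul_eq_zero (U := ball (0:E2) r)
    (f := fun x => f x - g x) (μ := volume) (hf.sub hg).locallyIntegrableOn (by
      intro φ h1 h2 h3
      obtain ⟨C, hC⟩ := h1.continuous.bounded_above_of_compact_support h2
      rw [← setIntegral_eq_of_tsupport_subset h3 (by intro x hx; simp [hx])]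
      simp only [smul_eq_mul, mul_sub]
      have hb : ∀ {f : E2 → ℝ}, IntegrableOn f (ball 0 r) →
          IntegrableOn (fun x => φ x * f x) (ball 0 r) := fun hf =>
        hf.bdd_mul (c := C) h1.continuous.aestronglyMeasurable (Eventually.of_forall hC)
      rw [integral_sub (hb hf) (hb hg), h φ ⟨h1, h2⟩ h3, sub_self])
  rw [EventuallyEq, ae_restrict_iff' measurableSet_ball]
  filter_upwards [key] with x hx hxr using sub_eq_zero.1 (hx hxr)

/-- Weak gradient on `ball 0 ρ` of a solution of the Poisson equation, obtained from the
truncated potential `gradKer δ`. -/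
def locGrad (δ ρ : ℝ) (u : E2 → ℝ) (μ : SignedMeasure E2) (i : Fin 2) (x : E2) : ℝ :=
  pot (gradKer δ i) 1 (μ.toJordanDecomposition.posPart.restrict (ball 0 (ρ + δ))) x
    - pot (gradKer δ i) 1 (μ.toJordanDecomposition.negPart.restrict (ball 0 (ρ + δ))) x
    - pot (pd i (remKer δ)) u (volume.restrict (ball 0 1)) x

lemma integrable_one_restrict (ν : Measure E2) [IsFiniteMeasure ν] : Integrable (1 : E2 → ℝ) ν :=
  integrable_const 1

lemma integrable_locGrad {δ : ℝ} (hδ : 0 < δ) (ρ : ℝ) {u : E2 → ℝ}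
    (hu : IntegrableOn u (ball 0 1)) (μ : SignedMeasure E2) (i : Fin 2) :
    Integrable (locGrad δ ρ u μ i) :=
  ((integrable_pot (integrable_gradKer hδ i) (integrable_one_restrict _)).sub
    (integrable_pot (integrable_gradKer hδ i) (integrable_one_restrict _))).sub
    (integrable_pot ((isTest_remKer hδ).pd i).integrable hu)

lemma IsTest.integrable_mul {φ f : E2 → ℝ} {ν : Measure E2} (hφ : IsTest φ)
    (hf : Integrable f ν) : Integrable (fun x => φ x * f x) ν := by
  obtain ⟨C, hC⟩ := hφ.continuous.bounded_above_of_compact_support hφ.2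
  exact hf.bdd_mul (c := C) hφ.continuous.aestronglyMeasurable (Eventually.of_forall hC)

lemma IsTest.integrable_mul' {φ f : E2 → ℝ} {ν : Measure E2} (hφ : IsTest φ)
    (hf : Integrable f ν) : Integrable (fun x => f x * φ x) ν := by
  simpa only [mul_comm] using hφ.integrable_mul hf

theorem integral_mul_locGrad {δ ρ : ℝ} (hδ : 0 < δ) (hρ : ρ + δ ≤ 1) {u : E2 → ℝ}
    (hu : IntegrableOn u (ball 0 1)) {μ : SignedMeasure E2} (h : WeakPoisson (ball 0 1) u μ)
    (i : Fin 2) {φ : E2 → ℝ} (hφ : IsTest φ) (hs : tsupport φ ⊆ ball 0 ρ) :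
    ∫ x in ball 0 1, u x * pd i φ x = -∫ x, φ x * locGrad δ ρ u μ i x := by
  have hk0 : ∀ z, δ < ‖z‖ → gradKer δ i z = 0 := fun z hz => gradKer_eq_zero hδ i hz.le
  have hki := integrable_gradKer hδ i
  have hΨ : IsTest (planeConv (gradKer δ i) φ) := hφ.planeConv hki hk0
  have hΨs : tsupport (planeConv (gradKer δ i) φ) ⊆ ball 0 (ρ + δ) :=
    tsupport_planeConv_subset_ball hk0 hs
  have hr : IsTest (pd i (remKer δ)) := (isTest_remKer hδ).pd i
  have hrc : IsTest (planeConv (pd i (remKer δ)) φ) := by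
    rw [← planeConv_pd_eq (isTest_remKer hδ) hφ]
    exact (hφ.pd i).planeConv (isTest_remKer hδ).integrable fun z => remKer_eq_zero hδ
  have h1 := h _ hΨ (hΨs.trans (ball_subset_ball hρ))
  simp only [lap_planeConv_gradKer hδ hφ, mul_sub] at h1
  rw [integral_sub ((hφ.pd i).integrable_mul' hu) (hrc.integrable_mul' hu), sInt,
    ← setIntegral_eq_of_tsupport_subset (ν := μ.toJordanDecomposition.posPart) hΨs
      (fun x hx => hx),
    ← setIntegral_eq_of_tsupport_subset (ν := μ.toJordanDecomposition.negPart) hΨs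
      (fun x hx => hx)] at h1
  have i1 := fun (ν : Measure E2) [IsFiniteMeasure ν] =>
    integrable_pot hki (integrable_one_restrict ν)
  have e1 := fun (ν : Measure E2) [IsFiniteMeasure ν] =>
    integral_mul_pot hki (integrable_one_restrict ν) hφ
  simp only [Pi.one_apply, one_mul] at e1
  have e3 := integral_mul_pot hr.integrable hu hφ
  simp only [locGrad, mul_sub]
  rw [integral_sub _ (hφ.integrable_mul (integrable_pot hr.integrable hu)),
    integral_sub (hφ.integrable_mul (i1 _)) (hφ.integrable_mul (i1 _)), e1, e1, e3]
  · linarith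
  · exact (hφ.integrable_mul (i1 _)).sub (hφ.integrable_mul (i1 _))

/-- Sum of the `L^q` norms of all kernels used in the local representation. -/
def kerConst (δ q : ℝ) : ℝ≥0∞ :=
  ∑ i, (eLpNorm (gradKer δ i) (ENNReal.ofReal q) volume
    + eLpNorm (pd i (remKer δ)) (ENNReal.ofReal q) volume)
    + eLpNorm (remKer δ) (ENNReal.ofReal q) volume

lemma IsTest.memLp {φ : E2 → ℝ} (hφ : IsTest φ) (p : ℝ≥0∞) : MemLp φ p :=
  hφ.continuous.memLp_of_hasCompactSupport hφ.2

lemma kerConst_ne_top {δ q : ℝ} (hδ : 0 < δ) (hq : q ∈ Ico (1:ℝ) 2) : kerConst δ q ≠ ∞ := by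
  unfold kerConst
  rw [ENNReal.add_ne_top, ENNReal.sum_ne_top]
  exact ⟨fun i _ => ENNReal.add_ne_top.2 ⟨(memLp_gradKer hδ i hq.1 hq.2).2.ne,
    (((isTest_remKer hδ).pd i).memLp _).2.ne⟩, ((isTest_remKer hδ).memLp _).2.ne⟩

lemma gradKer_le_kerConst (δ q : ℝ) (i : Fin 2) :
    eLpNorm (gradKer δ i) (ENNReal.ofReal q) volume ≤ kerConst δ q :=
  le_self_add.trans ((Finset.single_le_sum (f := fun i =>
    eLpNorm (gradKer δ i) (ENNReal.ofReal q) volume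
    + eLpNorm (pd i (remKer δ)) (ENNReal.ofReal q) volume) (fun _ _ => zero_le)
    (Finset.mem_univ i)).trans le_self_add)

lemma pd_remKer_le_kerConst (δ q : ℝ) (i : Fin 2) :
    eLpNorm (pd i (remKer δ)) (ENNReal.ofReal q) volume ≤ kerConst δ q :=
  le_add_self.trans ((Finset.single_le_sum (f := fun i =>
    eLpNorm (gradKer δ i) (ENNReal.ofReal q) volume
    + eLpNorm (pd i (remKer δ)) (ENNReal.ofReal q) volume) (fun _ _ => zero_le)
    (Finset.mem_univ i)).trans le_self_add)

lemma remKer_le_kerConst (δ q : ℝ) :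
    eLpNorm (remKer δ) (ENNReal.ofReal q) volume ≤ kerConst δ q :=
  le_add_self

lemma eLpNorm_locGrad_le {δ : ℝ} (hδ : 0 < δ) (ρ : ℝ) {u : E2 → ℝ}
    (hu : IntegrableOn u (ball 0 1)) (μ : SignedMeasure E2) (i : Fin 2) {q : ℝ} (hq : 1 ≤ q) :
    eLpNorm (locGrad δ ρ u μ i) (ENNReal.ofReal q) volume
      ≤ kerConst δ q * (tv μ (ball 0 (ρ + δ)) + ∫⁻ x in ball 0 1, ‖u x‖ₑ) := by
  have hki := integrable_gradKer hδ i
  have hr : IsTest (pd i (remKer δ)) := (isTest_remKer hδ).pd i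
  have i1 := fun (ν : Measure E2) [IsFiniteMeasure ν] =>
    (integrable_pot hki (integrable_one_restrict ν)).aestronglyMeasurable
  have i2 := (integrable_pot hr.integrable hu).aestronglyMeasurable
  have hq' : 1 ≤ ENNReal.ofReal q := by simpa using hq
  have b1 := fun (ν : Measure E2) [IsFiniteMeasure ν] =>
    eLpNorm_pot_le (measurable_gradKer δ i) (integrable_one_restrict ν) hq
  simp only [Pi.one_apply, enorm_one, lintegral_one] at b1
  have b2 := eLpNorm_pot_le hr.continuous.measurable hu hq
  have htv : tv μ (ball 0 (ρ + δ)) = μ.toJordanDecomposition.posPart (ball 0 (ρ + δ))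
      + μ.toJordanDecomposition.negPart (ball 0 (ρ + δ)) := rfl
  calc eLpNorm (locGrad δ ρ u μ i) (ENNReal.ofReal q) volume
      ≤ (eLpNorm (pot (gradKer δ i) 1
            (μ.toJordanDecomposition.posPart.restrict (ball 0 (ρ + δ)))) (ENNReal.ofReal q) volume
          + eLpNorm (pot (gradKer δ i) 1
            (μ.toJordanDecomposition.negPart.restrict (ball 0 (ρ + δ)))) (ENNReal.ofReal q) volume)
          + eLpNorm (pot (pd i (remKer δ)) u (volume.restrict (ball 0 1)))
            (ENNReal.ofReal q) volume :=
        (eLpNorm_sub_le ((i1 _).sub (i1 _)) i2 hq').trans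
          (add_le_add_left (eLpNorm_sub_le (i1 _) (i1 _) hq') _)
    _ ≤ (kerConst δ q * μ.toJordanDecomposition.posPart (ball 0 (ρ + δ))
          + kerConst δ q * μ.toJordanDecomposition.negPart (ball 0 (ρ + δ)))
          + kerConst δ q * ∫⁻ x in ball 0 1, ‖u x‖ₑ := by
        gcongr
        · refine (b1 _).trans ?_
          rw [Measure.restrict_apply_univ]
          gcongr
          exact gradKer_le_kerConst δ q i
        · refine (b1 _).trans ?_
          rw [Measure.restrict_apply_univ]
          gcongr
          exact gradKer_le_kerConst δ q i
        · refine b2.trans ?_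
          gcongr
          exact pd_remKer_le_kerConst δ q i
    _ = _ := by rw [htv]; ring

theorem eLpNorm_le_of_weakGrad {δ ρ : ℝ} (hδ : 0 < δ) (hρ : ρ + δ ≤ 1) {u : E2 → ℝ}
    (hu : IntegrableOn u (ball 0 1)) {g : Fin 2 → E2 → ℝ}
    (hg : ∀ i, IntegrableOn (g i) (ball 0 (ρ + δ)))
    (h : ∀ i φ, IsTest φ → tsupport φ ⊆ ball 0 (ρ + δ) →
      ∫ x in ball 0 1, u x * pd i φ x = -∫ x in ball 0 (ρ + δ), φ x * g i x)
    {q : ℝ} (hq : 1 ≤ q) :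
    eLpNorm u (ENNReal.ofReal q) (volume.restrict (ball 0 ρ))
      ≤ kerConst δ q * ((∑ i, ∫⁻ x in ball 0 (ρ + δ), ‖g i x‖ₑ) + ∫⁻ x in ball 0 1, ‖u x‖ₑ) := by
  have hq' : 1 ≤ ENNReal.ofReal q := by simpa using hq
  have hr := isTest_remKer hδ
  have i1 : ∀ i, Integrable (pot (gradKer δ i) (g i) (volume.restrict (ball 0 (ρ + δ)))) :=
    fun i => integrable_pot (integrable_gradKer hδ i) (hg i)
  have i2 := integrable_pot hr.integrable hu
  let v : E2 → ℝ := fun x => pot (remKer δ) u (volume.restrict (ball 0 1)) x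
    - ∑ i, pot (gradKer δ i) (g i) (volume.restrict (ball 0 (ρ + δ))) x
  have hvi : Integrable v := i2.sub (integrable_finsetSum _ fun i _ => i1 i)
  have hsub : ball (0:E2) ρ ⊆ ball 0 1 := ball_subset_ball (by linarith)
  have huv : u =ᵐ[volume.restrict (ball 0 ρ)] v := by
    refine ae_eq_of_integral_test_eq (hu.mono_set hsub) hvi.integrableOn fun φ hφ hs => ?_
    have hk0 : ∀ i z, δ < ‖z‖ → gradKer δ i z = 0 := fun i z hz => gradKer_eq_zero hδ i hz.le
    have hΨ : ∀ i, IsTest (planeConv (gradKer δ i) φ) := fun i =>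
      hφ.planeConv (integrable_gradKer hδ i) (hk0 i)
    have hrc : IsTest (planeConv (remKer δ) φ) :=
      hφ.planeConv hr.integrable fun z => remKer_eq_zero hδ
    have e1 : ∑ i, ∫ x in ball 0 1, u x * pd i (planeConv (gradKer δ i) φ) x
        = ∫ x in ball 0 1, (u x * φ x - u x * planeConv (remKer δ) φ x) := by
      rw [← integral_finsetSum _ fun i _ => ((hΨ i).pd i).integrable_mul' hu]
      congr 1; funext x
      rw [← Finset.mul_sum, ← mul_sub, ← sum_planeConv_gradKer_pd hδ hφ]
      simp only [pd_planeConv (integrable_gradKer hδ _) hφ]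
    rw [integral_sub (hφ.integrable_mul' hu) (hrc.integrable_mul' hu)] at e1
    have e2 : ∀ i, ∫ x in ball 0 1, u x * pd i (planeConv (gradKer δ i) φ) x
        = -∫ x, φ x * pot (gradKer δ i) (g i) (volume.restrict (ball 0 (ρ + δ))) x := by
      intro i
      rw [h i _ (hΨ i) (tsupport_planeConv_subset_ball (hk0 i) hs),
        integral_mul_pot (integrable_gradKer hδ i) (hg i) hφ]
      simp only [mul_comm]
    have e3 := integral_mul_pot hr.integrable hu hφ
    rw [setIntegral_eq_of_tsupport_subset hs (by intro x hx; simp [hx]),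
      setIntegral_eq_of_tsupport_subset hs (by intro x hx; simp [hx]),
      ← setIntegral_eq_of_tsupport_subset (hs.trans hsub) (by intro x hx; simp [hx])]
    simp only [v, mul_sub, Finset.mul_sum]
    rw [integral_sub (hφ.integrable_mul i2)
      (integrable_finsetSum _ fun i _ => hφ.integrable_mul (i1 i)),
      integral_finsetSum _ fun i _ => hφ.integrable_mul (i1 i), e3]
    simp only [e2, Finset.sum_neg_distrib] at e1
    simp only [mul_comm (φ _) (u _)]
    linarith
  rw [eLpNorm_congr_ae huv]
  refine (eLpNorm_mono_measure _ Measure.restrict_le_self).trans ?_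
  calc eLpNorm v (ENNReal.ofReal q) volume
      ≤ eLpNorm (pot (remKer δ) u (volume.restrict (ball 0 1))) (ENNReal.ofReal q) volume
        + ∑ i, eLpNorm (pot (gradKer δ i) (g i) (volume.restrict (ball 0 (ρ + δ))))
          (ENNReal.ofReal q) volume := by
        refine (eLpNorm_sub_le i2.aestronglyMeasurable
          (integrable_finsetSum _ fun i _ => i1 i).aestronglyMeasurable hq').trans ?_
        gcongr
        rw [← Finset.sum_fn]
        exact eLpNorm_sum_le (fun i _ => (i1 i).aestronglyMeasurable) hq'
    _ ≤ kerConst δ q * (∫⁻ x in ball 0 1, ‖u x‖ₑ)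
        + ∑ i, kerConst δ q * ∫⁻ x in ball 0 (ρ + δ), ‖g i x‖ₑ := by
        gcongr with i
        · refine (eLpNorm_pot_le hr.continuous.measurable hu hq).trans ?_
          gcongr
          exact remKer_le_kerConst δ q
        · refine (eLpNorm_pot_le (measurable_gradKer δ i) (hg i) hq).trans ?_
          gcongr
          exact gradKer_le_kerConst δ q i
    _ = _ := by rw [← Finset.mul_sum]; ring

lemma setIntegral_eq_setIntegral_of_tsupport_subset {S T : Set E2} {φ f : E2 → ℝ}
    (hs : tsupport φ ⊆ S) (hST : S ⊆ T) (hf : ∀ x, φ x = 0 → f x = 0) :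
    ∫ x in S, f x = ∫ x in T, f x := by
  rw [setIntegral_eq_of_tsupport_subset hs hf,
    setIntegral_eq_of_tsupport_subset (hs.trans hST) hf]

lemma integral_ball_mul_locGrad {δ ρ r : ℝ} (hδ : 0 < δ) (hρ : ρ + δ ≤ 1) {u : E2 → ℝ}
    (hu : IntegrableOn u (ball 0 1)) {μ : SignedMeasure E2} (h : WeakPoisson (ball 0 1) u μ)
    (i : Fin 2) {φ : E2 → ℝ} (hφ : IsTest φ) (hr : r ≤ ρ) (hs : tsupport φ ⊆ ball 0 r) :
    ∫ x in ball 0 r, φ x * locGrad δ ρ u μ i x = -∫ x in ball 0 1, u x * pd i φ x := by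
  rw [integral_mul_locGrad hδ hρ hu h i hφ (hs.trans (ball_subset_ball hr)), neg_neg,
    setIntegral_eq_of_tsupport_subset hs fun x hx => by simp [hx]]

theorem exists_weakGrad {u : E2 → ℝ} (hu : IntegrableOn u (ball 0 1)) {μ : SignedMeasure E2}
    (h : WeakPoisson (ball 0 1) u μ) :
    ∃ du : E2 → E2, IsWeakGrad (ball 0 1) u du ∧ ∀ ρ < 1, IntegrableOn du (ball 0 ρ) := by
  let ε : ℕ → ℝ := fun n => ((n:ℝ) + 1)⁻¹
  have hε : ∀ n, 0 < ε n := fun n => by positivity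
  have hε1 : ∀ n, 1 - ε n + ε n ≤ 1 := fun n => by simp
  let G : ℕ → Fin 2 → E2 → ℝ := fun n i => locGrad (ε n) (1 - ε n) u μ i
  have hGi : ∀ n i, Integrable (G n i) := fun n i => integrable_locGrad (hε n) _ hu μ i
  have hanti : ∀ {n m : ℕ}, n ≤ m → 1 - ε n ≤ 1 - ε m := by
    intro n m hnm
    have : (n:ℝ) ≤ m := by exact_mod_cast hnm
    simp only [ε]
    gcongr
  have hG : ∀ {n m : ℕ}, n ≤ m → ∀ i, G n i =ᵐ[volume.restrict (ball 0 (1 - ε n))] G m i := by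
    intro n m hnm i
    refine ae_eq_of_integral_test_eq (hGi n i).integrableOn (hGi m i).integrableOn
      fun φ hφ hs => ?_
    rw [integral_ball_mul_locGrad (hε n) (hε1 n) hu h i hφ le_rfl hs,
      integral_ball_mul_locGrad (hε m) (hε1 m) hu h i hφ (hanti hnm) hs]
  let N : E2 → ℕ := fun x => ⌊(1 - ‖x‖)⁻¹⌋₊
  have hN : ∀ {x : E2} {m : ℕ}, ‖x‖ < 1 - ε m → N x ≤ m ∧ ‖x‖ < 1 - ε (N x) := by
    intro x m hx
    have hpos : 0 < 1 - ‖x‖ := by linarith [hε m]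
    constructor
    · refine Nat.lt_succ_iff.1 ((Nat.floor_lt (by positivity)).2 ?_)
      push_cast
      exact (inv_lt_comm₀ hpos (by positivity)).2 (by simp only [ε] at hx; linarith)
    · have h1 : (1 - ‖x‖)⁻¹ < (N x : ℝ) + 1 := Nat.lt_floor_add_one _
      have := (inv_lt_comm₀ hpos (by positivity)).1 h1
      simp only [ε]
      linarith
  let du : E2 → E2 := fun x => WithLp.toLp 2 fun i => G (N x) i x
  have hdu : ∀ m i, (fun x => du x i) =ᵐ[volume.restrict (ball 0 (1 - ε m))] G m i := by
    intro m i
    have h1 : ∀ᵐ x, ∀ n, n ≤ m → x ∈ ball (0:E2) (1 - ε n) → G n i x = G m i x := by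
      rw [ae_all_iff]
      intro n
      by_cases hnm : n ≤ m
      · filter_upwards [(ae_restrict_iff' measurableSet_ball).1 (hG hnm i)] with x hx _ using hx
      · exact Eventually.of_forall fun x hx => absurd hx hnm
    rw [EventuallyEq, ae_restrict_iff' measurableSet_ball]
    filter_upwards [h1] with x hx hxm
    obtain ⟨h2, h3⟩ := hN (mem_ball_zero_iff.1 hxm)
    exact hx _ h2 (mem_ball_zero_iff.2 h3)
  have hex : ∀ R < 1, ∃ m, R < 1 - ε m := by
    intro R hR
    obtain ⟨m, hm⟩ := exists_nat_one_div_lt (sub_pos.2 hR)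
    exact ⟨m, by simp only [ε]; rw [one_div] at hm; linarith⟩
  refine ⟨du, fun φ hφ hs i => ?_, fun ρ hρ => ?_⟩
  · obtain ⟨R, hR, hsR⟩ := exists_tsupport_subset_closedBall hs
    obtain ⟨m, hm⟩ := hex R hR
    have hsm : tsupport φ ⊆ ball 0 (1 - ε m) := hsR.trans (closedBall_subset_ball hm)
    have h1 := integral_ball_mul_locGrad (hε m) (hε1 m) hu h i hφ le_rfl hsm
    have h2 : ∫ x in ball 0 (1 - ε m), φ x * du x i = ∫ x in ball 0 (1 - ε m), φ x * G m i x := by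
      refine integral_congr_ae ?_
      filter_upwards [hdu m i] with x hx
      rw [hx]
    have h3 := setIntegral_eq_setIntegral_of_tsupport_subset (T := ball 0 1) hsm
      (ball_subset_ball (by linarith [hε m])) (f := fun x => φ x * du x i) fun x hx => by simp [hx]
    rw [← h3, h2, h1, neg_neg]
    rfl
  · obtain ⟨m, hm⟩ := hex ρ hρ
    refine IntegrableOn.mono_set ?_ (ball_subset_ball hm.le)
    refine Integrable.of_eval_piLp fun i => ?_
    exact (hGi m i).integrableOn.congr (hdu m i).symm

/-- Constant in the interior estimate `eLpNorm_add_weakGrad_le`. -/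
def estConst (δ q : ℝ) : ℝ≥0∞ :=
  kerConst δ q * (2 * kerConst δ 1 + 1) + 2 * kerConst δ q

lemma estConst_ne_top {δ q : ℝ} (hδ : 0 < δ) (hq : q ∈ Ico (1:ℝ) 2) : estConst δ q ≠ ∞ := by
  have h1 := kerConst_ne_top hδ hq
  have h2 := kerConst_ne_top hδ (q := 1) ⟨le_rfl, by norm_num⟩
  unfold estConst
  finiteness

/-- Interior `W^{1,q}` estimate for the Poisson equation with measure data. -/
theorem eLpNorm_add_weakGrad_le {δ ρ : ℝ} (hδ : 0 < δ) (hρ : ρ + 2 * δ ≤ 1) {u : E2 → ℝ}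
    (hu : IntegrableOn u (ball 0 1)) {μ : SignedMeasure E2} (h : WeakPoisson (ball 0 1) u μ)
    {du : E2 → E2} (hdu : IsWeakGrad (ball 0 1) u du)
    (hdi : ∀ ρ < 1, IntegrableOn du (ball 0 ρ)) {q : ℝ} (hq : 1 ≤ q) :
    eLpNorm u (ENNReal.ofReal q) (volume.restrict (ball 0 ρ))
        + eLpNorm du (ENNReal.ofReal q) (volume.restrict (ball 0 ρ))
      ≤ estConst δ q * (tv μ (ball 0 (ρ + 2 * δ)) + ∫⁻ x in ball 0 1, ‖u x‖ₑ) := by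
  have hq' : 1 ≤ ENNReal.ofReal q := by simpa using hq
  have hρδ : ρ + δ < 1 := by linarith
  have h2 : ρ + δ + δ = ρ + 2 * δ := by ring
  have hg : ∀ i, IntegrableOn (fun x => du x i) (ball 0 (ρ + δ)) := fun i =>
    (EuclideanSpace.proj (𝕜 := ℝ) i).integrable_comp (hdi _ hρδ)
  have hw : ∀ i φ, IsTest φ → tsupport φ ⊆ ball 0 (ρ + δ) →
      ∫ x in ball 0 1, u x * pd i φ x = -∫ x in ball 0 (ρ + δ), φ x * du x i := by
    intro i φ hφ hs
    have hs1 : tsupport φ ⊆ ball 0 1 := hs.trans (ball_subset_ball hρδ.le)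
    rw [setIntegral_eq_setIntegral_of_tsupport_subset hs (ball_subset_ball hρδ.le)
      fun x hx => by simp [hx]]
    exact hdu φ hφ hs1 i
  set S := tv μ (ball 0 (ρ + 2 * δ)) + ∫⁻ x in ball 0 1, ‖u x‖ₑ with hS
  have hloc : ∀ i {p : ℝ}, 1 ≤ p → eLpNorm (fun x => du x i) (ENNReal.ofReal p)
      (volume.restrict (ball 0 (ρ + δ))) ≤ kerConst δ p * S := by
    intro i p hp
    have hae : (fun x => du x i) =ᵐ[volume.restrict (ball 0 (ρ + δ))]
        locGrad δ (ρ + δ) u μ i := by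
      refine ae_eq_of_integral_test_eq (hg i) (integrable_locGrad hδ _ hu μ i).integrableOn
        fun φ hφ hs => ?_
      rw [integral_ball_mul_locGrad hδ (by linarith) hu h i hφ le_rfl hs, hw i φ hφ hs, neg_neg]
    rw [eLpNorm_congr_ae hae, hS, ← h2]
    exact (eLpNorm_mono_measure _ Measure.restrict_le_self).trans
      (eLpNorm_locGrad_le hδ (ρ + δ) hu μ i hp)
  have hsub : ball (0:E2) ρ ⊆ ball 0 (ρ + δ) := ball_subset_ball (by linarith)
  have hA : eLpNorm u (ENNReal.ofReal q) (volume.restrict (ball 0 ρ))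
      ≤ kerConst δ q * ((∑ i : Fin 2, kerConst δ 1 * S) + S) := by
    refine (eLpNorm_le_of_weakGrad hδ hρδ.le hu hg hw hq).trans ?_
    gcongr with i
    · have := hloc i le_rfl
      rwa [ENNReal.ofReal_one, eLpNorm_one_eq_lintegral_enorm] at this
    · exact le_add_self
  have hB : eLpNorm du (ENNReal.ofReal q) (volume.restrict (ball 0 ρ))
      ≤ ∑ i : Fin 2, kerConst δ q * S := by
    calc eLpNorm du (ENNReal.ofReal q) (volume.restrict (ball 0 ρ))
        ≤ eLpNorm (∑ i : Fin 2, fun x => ‖du x i‖) (ENNReal.ofReal q)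
            (volume.restrict (ball 0 ρ)) := by
          refine eLpNorm_mono_real fun x => ?_
          rw [Finset.sum_apply, EuclideanSpace.norm_eq]
          refine Real.sqrt_le_iff.2 ⟨by positivity, ?_⟩
          simp only [Fin.sum_univ_two]
          nlinarith [mul_nonneg (norm_nonneg (du x 0)) (norm_nonneg (du x 1))]
      _ ≤ ∑ i : Fin 2, eLpNorm (fun x => ‖du x i‖) (ENNReal.ofReal q)
            (volume.restrict (ball 0 ρ)) :=
          eLpNorm_sum_le (fun i _ => ((hg i).mono_set hsub).aestronglyMeasurable.norm) hq'
      _ ≤ _ := by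
          gcongr with i
          rw [eLpNorm_norm]
          exact (eLpNorm_mono_measure _ (Measure.restrict_mono hsub le_rfl)).trans (hloc i hq)
  calc _ ≤ _ := add_le_add hA hB
    _ = _ := by simp only [Fin.sum_univ_two, estConst]; ring

instance (ν : SignedMeasure E2) : IsFiniteMeasure (tv ν) := by
  unfold tv SignedMeasure.totalVariation
  infer_instance

lemma abs_sub_clip_le {s t : ℝ} (hs : |s| ≤ 1) : |s - max (-1) (min 1 t)| ≤ |s - t| := by
  rw [abs_le] at hs
  rcases le_total 1 t with h | h
  · rw [min_eq_left h, max_eq_right (by norm_num), abs_sub_comm, abs_sub_comm s,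
      abs_of_nonneg (by linarith), abs_of_nonneg (by linarith)]
    linarith
  · rw [min_eq_right h]
    rcases le_total (-1) t with h2 | h2
    · rw [max_eq_right h2]
    · rw [max_eq_left h2, abs_of_nonneg (by linarith), abs_of_nonneg (by linarith)]
      linarith

lemma Continuous.integrable_of_abs_le {f : E2 → ℝ} (hf : Continuous f) {C : ℝ}
    (hC : ∀ x, |f x| ≤ C) (ν : Measure E2) [IsFiniteMeasure ν] : Integrable f ν :=
  Integrable.of_bound hf.aestronglyMeasurable C (Eventually.of_forall hC)

lemma integral_tv_le {ν : SignedMeasure E2} {η : E2 → ℝ} (hη : Continuous η)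
    (h01 : ∀ x, η x ∈ Icc (0:ℝ) 1) {C : ℝ}
    (hC : ∀ f : BoundedContinuousFunction E2 ℝ, ‖f‖ ≤ 1 → sInt ν (fun x => η x * f x) ≤ C) :
    ∫ x, η x ∂tv ν ≤ C := by
  obtain ⟨A, hA, hP, hN⟩ := ν.toJordanDecomposition.mutuallySingular
  set P := ν.toJordanDecomposition.posPart with hPdef
  set N := ν.toJordanDecomposition.negPart with hNdef
  have htv : tv ν = P + N := rfl
  have hηabs : ∀ x, |η x| ≤ 1 := fun x => abs_le.2 ⟨by linarith [(h01 x).1], (h01 x).2⟩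
  let s : E2 → ℝ := fun x => 1 - A.indicator (fun _ => (2:ℝ)) x
  have hsA : ∀ x ∈ A, s x = -1 := fun x hx => by simp only [s, indicator_of_mem hx]; norm_num
  have hsAc : ∀ x ∉ A, s x = 1 := fun x hx => by simp only [s, indicator_of_notMem hx]; norm_num
  have hs1 : ∀ x, |s x| ≤ 1 := fun x => by
    by_cases hx : x ∈ A
    · simp [hsA x hx]
    · simp [hsAc x hx]
  have hsm : Measurable s := measurable_const.sub (measurable_const.indicator hA)
  have hsi : ∀ (m : Measure E2) [IsFiniteMeasure m], Integrable s m := fun m _ =>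
    Integrable.of_bound hsm.aestronglyMeasurable 1 (Eventually.of_forall hs1)
  have hηi : ∀ (m : Measure E2) [IsFiniteMeasure m], Integrable η m := fun m _ =>
    hη.integrable_of_abs_le hηabs m
  have eP : ∫ x, η x * s x ∂P = ∫ x, η x ∂P := by
    refine integral_congr_ae ?_
    filter_upwards [measure_eq_zero_iff_ae_notMem.1 hP] with x hx
    rw [hsAc x hx, mul_one]
  have eN : ∫ x, η x * s x ∂N = -∫ x, η x ∂N := by
    rw [← integral_neg]
    refine integral_congr_ae ?_
    filter_upwards [measure_eq_zero_iff_ae_notMem.1 hN] with x hx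
    rw [hsA x (by simpa using hx)]
    ring
  refine le_of_forall_pos_le_add fun ε hε => ?_
  obtain ⟨f, hf, hfi⟩ := (hsi (tv ν)).exists_boundedContinuous_integral_sub_le hε
  let g : BoundedContinuousFunction E2 ℝ :=
    BoundedContinuousFunction.ofNormedAddCommGroup (fun x => max (-1) (min 1 (f x)))
      (by fun_prop) 1 fun x => abs_le.2 ⟨le_max_left _ _, max_le (by norm_num) (min_le_left _ _)⟩
  have hg := hC g (BoundedContinuousFunction.norm_ofNormedAddCommGroup_le _ zero_le_one _)
  have hgi : ∀ (m : Measure E2) [IsFiniteMeasure m], Integrable (fun x => η x * g x) m :=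
    fun m _ => (g.integrable m).bdd_mul (c := 1) hη.aestronglyMeasurable
      (Eventually.of_forall hηabs)
  have hsη : ∀ (m : Measure E2) [IsFiniteMeasure m], Integrable (fun x => η x * s x) m :=
    fun m _ => (hsi m).bdd_mul (c := 1) hη.aestronglyMeasurable (Eventually.of_forall hηabs)
  have hd : ∀ x, |η x * s x - η x * g x| ≤ ‖s x - f x‖ := fun x => by
    rw [← mul_sub, abs_mul]
    exact (mul_le_of_le_one_left (abs_nonneg _) (hηabs x)).trans (abs_sub_clip_le (hs1 x))
  have hdi : ∀ (m : Measure E2) [IsFiniteMeasure m], Integrable (fun x => ‖s x - f x‖) m :=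
    fun m _ => ((hsi m).sub (f.integrable m)).norm
  have hm : ∀ (m : Measure E2) [IsFiniteMeasure m],
      |(∫ x, η x * s x ∂m) - ∫ x, η x * g x ∂m| ≤ ∫ x, ‖s x - f x‖ ∂m := fun m _ => by
    rw [← integral_sub (hsη m) (hgi m)]
    exact abs_integral_le_integral_abs.trans
      (integral_mono ((hsη m).sub (hgi m)).abs (hdi m) hd)
  rw [htv, integral_add_measure (hdi P) (hdi N)] at hf
  rw [htv, integral_add_measure (hηi P) (hηi N)]
  have h1 := (abs_le.1 (hm P)).2
  have h2 := (abs_le.1 (hm N)).1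
  rw [eP] at h1
  rw [eN] at h2
  rw [sInt] at hg
  linarith

lemma abs_sInt_le {ν : SignedMeasure E2} {f : E2 → ℝ} {C : ℝ} (hC : ∀ x, |f x| ≤ C) :
    |sInt ν f| ≤ C * (ν.toJordanDecomposition.posPart.real univ
      + ν.toJordanDecomposition.negPart.real univ) := by
  have h : ∀ (m : Measure E2) [IsFiniteMeasure m], |∫ x, f x ∂m| ≤ C * m.real univ := fun m _ =>
    norm_integral_le_of_norm_le_const (f := f) (Eventually.of_forall hC)
  rw [sInt, mul_add]
  exact (abs_sub _ _).trans (add_le_add (h _) (h _))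

/-- The functional `f ↦ ∫ η f dν` on bounded continuous functions. -/
def sIntCLM (ν : SignedMeasure E2) (η : E2 → ℝ) (hη : Continuous η) (h1 : ∀ x, |η x| ≤ 1) :
    BoundedContinuousFunction E2 ℝ →L[ℝ] ℝ :=
  LinearMap.mkContinuous
    { toFun := fun f => sInt ν fun x => η x * f x
      map_add' := fun f g => by
        have hi : ∀ (f : BoundedContinuousFunction E2 ℝ) (m : Measure E2) [IsFiniteMeasure m],
            Integrable (fun x => η x * f x) m := fun f m _ =>
          (f.integrable m).bdd_mul (c := 1) hη.aestronglyMeasurable (Eventually.of_forall h1)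
        simp only [sInt, BoundedContinuousFunction.add_apply, mul_add]
        rw [integral_add (hi f _) (hi g _), integral_add (hi f _) (hi g _)]
        ring
      map_smul' := fun c f => by
        simp only [sInt, BoundedContinuousFunction.smul_apply, smul_eq_mul, mul_left_comm _ c,
          integral_const_mul, RingHom.id_apply]
        ring }
    (ν.toJordanDecomposition.posPart.real univ + ν.toJordanDecomposition.negPart.real univ)
    fun f => by
      refine (abs_sInt_le (C := ‖f‖) fun x => ?_).trans_eq (mul_comm _ _)
      rw [abs_mul]
      exact (mul_le_of_le_one_left (abs_nonneg _) (h1 x)).trans (f.norm_coe_le_norm x)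

lemma sIntCLM_apply (ν : SignedMeasure E2) (η : E2 → ℝ) (hη : Continuous η)
    (h1 : ∀ x, |η x| ≤ 1) (f : BoundedContinuousFunction E2 ℝ) :
    sIntCLM ν η hη h1 f = sInt ν fun x => η x * f x := rfl

/-- Weakly bounded sequences of signed measures on the disk have locally bounded variation. -/
theorem exists_tv_ball_le {μs : ℕ → SignedMeasure E2}
    (hb : ∀ φ : E2 → ℝ, Continuous φ → HasCompactSupport φ → tsupport φ ⊆ ball (0:E2) 1 →
      ∃ C, ∀ k, |sInt (μs k) φ| ≤ C) {r : ℝ} (hr : r < 1) :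
    ∃ C : ℝ, ∀ k, tv (μs k) (ball 0 r) ≤ ENNReal.ofReal C := by
  obtain ⟨R, hrR, hR1⟩ := exists_between hr
  obtain ⟨η, hη1, hη0, -, h01⟩ := exists_continuous_one_zero_of_isCompact
    (isCompact_closedBall (0:E2) r) (t := (ball (0:E2) R)ᶜ) isOpen_ball.isClosed_compl
    (disjoint_compl_right_iff_subset.2 (closedBall_subset_ball hrR))
  have hηabs : ∀ x, |η x| ≤ 1 := fun x => abs_le.2 ⟨by linarith [(h01 x).1], (h01 x).2⟩
  have hprod : ∀ f : BoundedContinuousFunction E2 ℝ,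
      tsupport (fun x => η x * f x) ⊆ closedBall 0 R := fun f => by
    refine closure_minimal (fun x hx => ?_) isClosed_closedBall
    by_contra hc
    refine hx ?_
    have : η x = 0 := hη0 fun h => hc (ball_subset_closedBall h)
    simp [this]
  obtain ⟨C, hC⟩ := banach_steinhaus (g := fun k => sIntCLM (μs k) η η.continuous hηabs) fun f => by
    obtain ⟨C, hC⟩ := hb (fun x => η x * f x) (by fun_prop)
      ((isCompact_closedBall (0:E2) R).of_isClosed_subset (isClosed_tsupport _) (hprod f))
      ((hprod f).trans (closedBall_subset_ball hR1))
    exact ⟨C, hC⟩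
  refine ⟨C, fun k => ?_⟩
  have h1 : ∫ x, η x ∂tv (μs k) ≤ C := integral_tv_le η.continuous h01 fun f hf => by
    rw [← sIntCLM_apply _ _ η.continuous hηabs]
    refine (le_abs_self _).trans (((sIntCLM (μs k) η η.continuous hηabs).le_opNorm f).trans ?_)
    exact (mul_le_of_le_one_right (norm_nonneg _) hf).trans (hC k)
  refine le_trans ?_ (ENNReal.ofReal_le_ofReal h1)
  rw [ofReal_integral_eq_lintegral_ofReal (η.continuous.integrable_of_abs_le hηabs _)
    (Eventually.of_forall fun x => (h01 x).1)]
  calc tv (μs k) (ball 0 r) = ∫⁻ x in ball 0 r, 1 ∂tv (μs k) := by simp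
    _ ≤ ∫⁻ x in ball 0 r, ENNReal.ofReal (η x) ∂tv (μs k) :=
        setLIntegral_mono' measurableSet_ball fun x hx => by
          rw [hη1 (ball_subset_closedBall hx)]; simp
    _ ≤ _ := setLIntegral_le_lintegral _ _

lemma isTest_lap {φ : E2 → ℝ} (hφ : IsTest φ) : IsTest (lap φ) := by
  have h : lap φ = fun x => pd 0 (pd 0 φ) x + pd 1 (pd 1 φ) x := by
    funext x
    rw [lap_eq_sum_pd, Fin.sum_univ_two]
  rw [h]
  exact ⟨((hφ.pd 0).pd 0).1.add ((hφ.pd 1).pd 1).1, ((hφ.pd 0).pd 0).2.add ((hφ.pd 1).pd 1).2⟩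

lemma tendsto_integral_mul_of_tendsto_L1 {us : ℕ → E2 → ℝ} {u : E2 → ℝ}
    (hus : ∀ k, IntegrableOn (us k) (ball (0:E2) 1) volume)
    (hu : IntegrableOn u (ball (0:E2) 1) volume)
    (hL1 : Tendsto (fun k => ∫ x in ball (0:E2) 1, |us k x - u x|) atTop (𝓝 0))
    {ψ : E2 → ℝ} (hψ : IsTest ψ) :
    Tendsto (fun k => ∫ x in ball (0:E2) 1, us k x * ψ x) atTop
      (𝓝 (∫ x in ball (0:E2) 1, u x * ψ x)) := by
  obtain ⟨C, hC⟩ := hψ.continuous.bounded_above_of_compact_support hψ.2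
  rw [tendsto_iff_dist_tendsto_zero]
  have hlim := hL1.mul_const C
  rw [zero_mul] at hlim
  refine squeeze_zero (fun _ => dist_nonneg) (fun k => ?_) hlim
  rw [Real.dist_eq, ← integral_sub (hψ.integrable_mul' (hus k)) (hψ.integrable_mul' hu),
    ← integral_mul_const]
  refine abs_integral_le_integral_abs.trans (integral_mono
    ((hψ.integrable_mul' (hus k)).sub (hψ.integrable_mul' hu)).abs
    (((hus k).sub hu).abs.mul_const C) fun x => ?_)
  simp only [← sub_mul, abs_mul]
  exact mul_le_mul_of_nonneg_left (hC x) (abs_nonneg _)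

theorem WeakPoisson.of_tendsto {μs : ℕ → SignedMeasure E2} {μ : SignedMeasure E2}
    {us : ℕ → E2 → ℝ} {u : E2 → ℝ}
    (hus : ∀ k, IntegrableOn (us k) (ball (0:E2) 1) volume)
    (hu : IntegrableOn u (ball (0:E2) 1) volume)
    (hsol : ∀ k, WeakPoisson (ball (0:E2) 1) (us k) (μs k))
    (hμconv : ∀ φ : E2 → ℝ, Continuous φ → HasCompactSupport φ →
      tsupport φ ⊆ ball (0:E2) 1 →
      Tendsto (fun k => sInt (μs k) φ) atTop (𝓝 (sInt μ φ)))
    (hL1 : Tendsto (fun k => ∫ x in ball (0:E2) 1, |us k x - u x|) atTop (𝓝 0)) :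
    WeakPoisson (ball (0:E2) 1) u μ := fun φ hφ hs => by
  have h1 := tendsto_integral_mul_of_tendsto_L1 hus hu hL1 (isTest_lap hφ)
  simp only [hsol _ φ hφ hs] at h1
  exact tendsto_nhds_unique h1 (hμconv φ hφ.continuous hφ.2 hs).neg

lemma setIntegral_norm_rpow_le {F : Type*} [NormedAddCommGroup F] {f : E2 → F} {q : ℝ}
    (hq : 1 ≤ q) {K S : Set E2} (hKS : K ⊆ S) {c : ℝ≥0∞} (hc : c ≠ ∞)
    (h : eLpNorm f (ENNReal.ofReal q) (volume.restrict S) ≤ c) :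
    ∫ x in K, ‖f x‖ ^ q ≤ c.toReal ^ q := by
  have hq0 : 0 < q := by linarith
  have hle : ∫⁻ x in K, ‖f x‖ₑ ^ q ≤ c ^ q := by
    have h1 := ENNReal.rpow_le_rpow
      ((eLpNorm_mono_measure f (Measure.restrict_mono hKS le_rfl)).trans h) hq0.le
    rwa [eLpNorm_eq_lintegral_rpow_enorm_toReal (by simpa using hq0) (by simp),
      ENNReal.toReal_ofReal hq0.le, ← ENNReal.rpow_mul, one_div_mul_cancel hq0.ne',
      ENNReal.rpow_one] at h1
  rw [ENNReal.toReal_rpow]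
  refine (le_abs_self _).trans ((norm_integral_le_lintegral_norm
    (fun x => ‖f x‖ ^ q)).trans
    (ENNReal.toReal_mono (ENNReal.rpow_ne_top_of_nonneg hq0.le hc) (le_trans (le_of_eq ?_) hle)))
  refine lintegral_congr fun x => ?_
  rw [ofReal_norm, Real.enorm_rpow_of_nonneg (norm_nonneg _) hq0.le, enorm_norm]

lemma exists_integral_abs_le {us : ℕ → E2 → ℝ} {u : E2 → ℝ}
    (hus : ∀ k, IntegrableOn (us k) (ball (0:E2) 1) volume)
    (hu : IntegrableOn u (ball (0:E2) 1) volume)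
    (hL1 : Tendsto (fun k => ∫ x in ball (0:E2) 1, |us k x - u x|) atTop (𝓝 0)) :
    ∃ B : ℝ, ∀ k, ∫⁻ x in ball (0:E2) 1, ‖us k x‖ₑ ≤ ENNReal.ofReal B := by
  obtain ⟨B, hB⟩ := hL1.bddAbove_range
  refine ⟨B + ∫ x in ball (0:E2) 1, |u x|, fun k => ?_⟩
  rw [← ofReal_integral_norm_eq_lintegral_enorm (hus k)]
  refine ENNReal.ofReal_le_ofReal (le_trans ?_ (add_le_add_left (hB ⟨k, rfl⟩) _))
  refine le_of_le_of_eq ?_ (integral_add ((hus k).sub hu).abs hu.abs)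
  refine integral_mono (hus k).norm (((hus k).sub hu).abs.add hu.abs) fun x => ?_
  have := abs_add_le (us k x - u x) (u x)
  simpa using this

/-- Uniform interior `W^{1,q}` bounds for weakly convergent data. -/
theorem exists_eLpNorm_add_weakGrad_le {μs : ℕ → SignedMeasure E2} {us : ℕ → E2 → ℝ}
    {u : E2 → ℝ} (hus : ∀ k, IntegrableOn (us k) (ball (0:E2) 1) volume)
    (hu : IntegrableOn u (ball (0:E2) 1) volume)
    (hsol : ∀ k, WeakPoisson (ball (0:E2) 1) (us k) (μs k))
    (hb : ∀ φ : E2 → ℝ, Continuous φ → HasCompactSupport φ → tsupport φ ⊆ ball (0:E2) 1 →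
      ∃ C, ∀ k, |sInt (μs k) φ| ≤ C)
    (hL1 : Tendsto (fun k => ∫ x in ball (0:E2) 1, |us k x - u x|) atTop (𝓝 0))
    {dus : ℕ → E2 → E2} (hdus : ∀ k, IsWeakGrad (ball (0:E2) 1) (us k) (dus k))
    (hdi : ∀ k, ∀ ρ < 1, IntegrableOn (dus k) (ball 0 ρ)) {R q : ℝ} (hR : R < 1)
    (hq : q ∈ Ico (1:ℝ) 2) :
    ∃ c : ℝ≥0∞, c ≠ ∞ ∧ ∀ k, eLpNorm (us k) (ENNReal.ofReal q) (volume.restrict (ball 0 R))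
      + eLpNorm (dus k) (ENNReal.ofReal q) (volume.restrict (ball 0 R)) ≤ c := by
  have hδ : 0 < (1 - R) / 4 := by linarith
  obtain ⟨B, hB⟩ := exists_integral_abs_le hus hu hL1
  obtain ⟨C, hC⟩ := exists_tv_ball_le hb (r := R + 2 * ((1 - R) / 4)) (by linarith)
  refine ⟨estConst ((1 - R) / 4) q * (ENNReal.ofReal C + ENNReal.ofReal B),
    ENNReal.mul_ne_top (estConst_ne_top hδ hq) (by finiteness), fun k => ?_⟩
  refine (eLpNorm_add_weakGrad_le hδ (by linarith) (hus k) (hsol k) (hdus k) (hdi k) hq.1).trans ?_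
  gcongr
  · exact hC k
  · exact hB k

lemma abs_setIntegral_sub_mul_le {S : Set E2} {f g w : E2 → ℝ} {ε C : ℝ}
    (hfg : ∀ x, |f x - g x| ≤ ε) (hf : IntegrableOn (fun x => f x * w x) S)
    (hg : IntegrableOn (fun x => g x * w x) S) (hw : IntegrableOn w S)
    (hC : ∫ x in S, |w x| ≤ C) (hε : 0 ≤ ε) :
    |(∫ x in S, f x * w x) - ∫ x in S, g x * w x| ≤ ε * C := by
  rw [← integral_sub hf hg]
  refine abs_integral_le_integral_abs.trans (le_trans ?_ (mul_le_mul_of_nonneg_left hC hε))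
  rw [← integral_const_mul]
  refine integral_mono (hf.sub hg).abs (hw.abs.const_mul ε) fun x => ?_
  simp only [← sub_mul, abs_mul]
  exact mul_le_mul_of_nonneg_right (hfg x) (abs_nonneg _)

/-- Convergence against test functions upgrades to convergence against continuous functions
for sequences bounded in `L¹`. -/
theorem tendsto_integral_mul_of_isTest {R C : ℝ} {ws : ℕ → E2 → ℝ} {w : E2 → ℝ}
    (hws : ∀ k, IntegrableOn (ws k) (ball 0 R)) (hw : IntegrableOn w (ball 0 R))
    (hC : ∀ k, ∫ x in ball 0 R, |ws k x| ≤ C)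
    (h : ∀ φ, IsTest φ → tsupport φ ⊆ ball 0 R →
      Tendsto (fun k => ∫ x in ball 0 R, φ x * ws k x) atTop (𝓝 (∫ x in ball 0 R, φ x * w x)))
    {f : E2 → ℝ} (hf : Continuous f) (hfc : HasCompactSupport f) (hfs : tsupport f ⊆ ball 0 R) :
    Tendsto (fun k => ∫ x in ball 0 R, f x * ws k x) atTop (𝓝 (∫ x in ball 0 R, f x * w x)) := by
  set C' := ∫ x in ball 0 R, |w x| with hC'
  have hC0 : 0 ≤ C := (integral_nonneg fun _ => abs_nonneg _).trans (hC 0)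
  have hC'0 : 0 ≤ C' := integral_nonneg fun _ => abs_nonneg _
  rw [Metric.tendsto_atTop]
  intro ε hε
  set η := ε / (2 * (C + C' + 1)) with hη
  have hη0 : 0 < η := by positivity
  obtain ⟨g, hg, hgf, hgs⟩ := hf.exists_contDiff_approx (n := (⊤ : ℕ∞))
    (ε := fun _ => η) continuous_const fun _ => hη0
  have hgs' : tsupport g ⊆ tsupport f := closure_mono hgs
  have hgt : IsTest g := ⟨hg, hfc.mono hgs⟩
  obtain ⟨n, hn⟩ := Metric.tendsto_atTop.1 (h g hgt (hgs'.trans hfs)) (ε / 2) (by positivity)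
  refine ⟨n, fun k hk => ?_⟩
  obtain ⟨M, hM⟩ := hf.bounded_above_of_compact_support hfc
  have hfi : ∀ {w : E2 → ℝ}, IntegrableOn w (ball 0 R) →
      IntegrableOn (fun x => f x * w x) (ball 0 R) := fun hw =>
    hw.bdd_mul (c := M) hf.aestronglyMeasurable (Eventually.of_forall hM)
  have hd : ∀ x, |f x - g x| ≤ η := fun x => by
    rw [abs_sub_comm]
    exact (hgf x).le
  have h1 := abs_setIntegral_sub_mul_le hd (hfi (hws k)) (hgt.integrable_mul (hws k)) (hws k)
    (hC k) hη0.le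
  have h2 := abs_setIntegral_sub_mul_le hd (hfi hw) (hgt.integrable_mul hw) hw le_rfl hη0.le
  have h3 := hn k hk
  rw [Real.dist_eq] at h3 ⊢
  have h4 : η * C + η * C' < ε / 2 := by
    have : η * (C + C' + 1) = ε / 2 := by rw [hη]; field_simp
    linarith
  rw [abs_le] at h1 h2
  rw [abs_lt] at h3 ⊢
  constructor <;> linarith

lemma ip_eq (a b : E2) : ip a b = b 0 * a 0 + b 1 * a 1 := by
  simp [ip, PiLp.inner_apply, Fin.sum_univ_two]

lemma IsWeakGrad.integral_mul_pd {u : E2 → ℝ} {du : E2 → E2} {R : ℝ} (hR : R ≤ 1)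
    (h : IsWeakGrad (ball 0 1) u du) {φ : E2 → ℝ} (hφ : IsTest φ) (hs : tsupport φ ⊆ ball 0 R)
    (i : Fin 2) :
    ∫ x in ball 0 R, φ x * du x i = -∫ x in ball 0 1, u x * pd i φ x := by
  rw [setIntegral_eq_setIntegral_of_tsupport_subset hs (ball_subset_ball hR)
    fun x hx => by simp [hx]]
  exact neg_eq_iff_eq_neg.1 (h φ hφ (hs.trans (ball_subset_ball hR)) i).symm

lemma abs_apply_le_norm (v : E2) (i : Fin 2) : |v i| ≤ ‖v‖ := by
  simpa using PiLp.norm_apply_le v i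

theorem tendsto_integral_ip {us : ℕ → E2 → ℝ} {u : E2 → ℝ}
    (hus : ∀ k, IntegrableOn (us k) (ball (0:E2) 1) volume)
    (hu : IntegrableOn u (ball (0:E2) 1) volume)
    (hL1 : Tendsto (fun k => ∫ x in ball (0:E2) 1, |us k x - u x|) atTop (𝓝 0))
    {dus : ℕ → E2 → E2} {du : E2 → E2}
    (hdus : ∀ k, IsWeakGrad (ball (0:E2) 1) (us k) (dus k))
    (hdu : IsWeakGrad (ball (0:E2) 1) u du) {R : ℝ} (hR : R < 1)
    (hdi : ∀ k, IntegrableOn (dus k) (ball 0 R)) (hdui : IntegrableOn du (ball 0 R))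
    {C : ℝ} (hC : ∀ k, ∫ x in ball 0 R, ‖dus k x‖ ≤ C) {K : Set E2} (hK : IsCompact K)
    (hKR : K ⊆ ball 0 R) {Φ : E2 → E2} (hΦ : Continuous Φ) (hΦK : ∀ x, x ∉ K → Φ x = 0) :
    Tendsto (fun k => ∫ x in ball (0:E2) 1, ip (dus k x) (Φ x)) atTop
      (𝓝 (∫ x in ball (0:E2) 1, ip (du x) (Φ x))) := by
  have hΦc : ∀ i, Continuous fun x => Φ x i := fun i => by fun_prop
  have hts : ∀ i, tsupport (fun x => Φ x i) ⊆ K := fun i =>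
    closure_minimal (fun x hx => by_contra fun hxK => hx (by simp [hΦK x hxK])) hK.isClosed
  have hcs : ∀ i, HasCompactSupport fun x => Φ x i := fun i =>
    hK.of_isClosed_subset (isClosed_tsupport _) (hts i)
  have hcomp : ∀ {v : E2 → E2}, IntegrableOn v (ball 0 R) → ∀ i,
      IntegrableOn (fun x => v x i) (ball 0 R) := fun hv i =>
    (EuclideanSpace.proj (𝕜 := ℝ) i).integrable_comp hv
  have hint : ∀ {v : E2 → E2}, IntegrableOn v (ball 0 R) →
      ∫ x in ball (0:E2) 1, ip (v x) (Φ x)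
        = (∫ x in ball 0 R, Φ x 0 * v x 0) + ∫ x in ball 0 R, Φ x 1 * v x 1 := by
    intro v hv
    have hi : ∀ i, IntegrableOn (fun x => Φ x i * v x i) (ball 0 R) := fun i => by
      obtain ⟨M, hM⟩ := (hΦc i).bounded_above_of_compact_support (hcs i)
      exact (hcomp hv i).bdd_mul (c := M) (hΦc i).aestronglyMeasurable (Eventually.of_forall hM)
    rw [← integral_add (hi 0) (hi 1)]
    simp only [ip_eq]
    refine (setIntegral_eq_of_subset_of_forall_sdiff_eq_zero measurableSet_ball
      (ball_subset_ball hR.le) fun x hx => ?_)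
    simp [hΦK x fun h => hx.2 (hKR h)]
  have key : ∀ i, Tendsto (fun k => ∫ x in ball 0 R, Φ x i * dus k x i) atTop
      (𝓝 (∫ x in ball 0 R, Φ x i * du x i)) := fun i => by
    refine tendsto_integral_mul_of_isTest (C := C) (fun k => hcomp (hdi k) i) (hcomp hdui i)
      (fun k => (integral_mono (hcomp (hdi k) i).abs (hdi k).norm
        fun x => abs_apply_le_norm _ i).trans (hC k)) (fun φ hφ hs => ?_) (hΦc i) (hcs i)
      ((hts i).trans hKR)
    simp only [(hdus _).integral_mul_pd hR.le hφ hs, hdu.integral_mul_pd hR.le hφ hs]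
    exact (tendsto_integral_mul_of_tendsto_L1 hus hu hL1 (hφ.pd i)).neg
  simp only [hint (hdi _), hint hdui]
  exact (key 0).add (key 1)

lemma abs_sInt_le_tv_ball {ν : SignedMeasure E2} {φ : E2 → ℝ} {C : ℝ} (hC : ∀ x, |φ x| ≤ C)
    (hs : tsupport φ ⊆ ball 0 1) : |sInt ν φ| ≤ C * (tv ν (ball 0 1)).toReal := by
  have h : ∀ (m : Measure E2) [IsFiniteMeasure m],
      |∫ x, φ x ∂m| ≤ C * (m (ball 0 1)).toReal := fun m _ => by
    rw [← setIntegral_eq_of_tsupport_subset (ν := m) hs fun x hx => hx]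
    exact norm_setIntegral_le_of_norm_le_const (f := φ) (measure_lt_top _ _) fun x _ => hC x
  have htv : tv ν (ball 0 1) = ν.toJordanDecomposition.posPart (ball 0 1)
      + ν.toJordanDecomposition.negPart (ball 0 1) := rfl
  rw [htv, ENNReal.toReal_add (measure_ne_top _ _) (measure_ne_top _ _), mul_add]
  exact (abs_sub _ _).trans (add_le_add (h _) (h _))

lemma IsWeakGrad.sub {u v : E2 → ℝ} (hu : IntegrableOn u (ball 0 1))
    (hv : IntegrableOn v (ball 0 1)) {du dv : E2 → E2} (h1 : IsWeakGrad (ball 0 1) u du)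
    (h2 : IsWeakGrad (ball 0 1) v dv) (hdu : ∀ ρ < 1, IntegrableOn du (ball 0 ρ))
    (hdv : ∀ ρ < 1, IntegrableOn dv (ball 0 ρ)) :
    IsWeakGrad (ball 0 1) (fun x => u x - v x) (fun x => du x - dv x) := fun φ hφ hs i => by
  obtain ⟨R, hR1, hsR⟩ := exists_lt_subset_ball (isClosed_tsupport φ) hs
  have hcomp : ∀ {w : E2 → E2}, IntegrableOn w (ball 0 R) →
      IntegrableOn (fun x => φ x * w x i) (ball 0 R) := fun hw =>
    hφ.integrable_mul ((EuclideanSpace.proj (𝕜 := ℝ) i).integrable_comp hw)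
  rw [← setIntegral_eq_setIntegral_of_tsupport_subset (T := ball 0 1)
    (f := fun x => φ x * (du x - dv x) i) hsR (ball_subset_ball hR1.le) fun x hx => by simp [hx]]
  simp only [PiLp.sub_apply, mul_sub, sub_mul]
  rw [integral_sub (hcomp (hdu R hR1)) (hcomp (hdv R hR1)), h1.integral_mul_pd hR1.le hφ hsR,
    h2.integral_mul_pd hR1.le hφ hsR]
  refine (integral_sub ((hφ.pd i).integrable_mul' hu) ((hφ.pd i).integrable_mul' hv)).trans ?_
  ring

theorem tendsto_setIntegral_rpow_sub {μs : ℕ → SignedMeasure E2} {us : ℕ → E2 → ℝ}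
    {u : E2 → ℝ} (hus : ∀ k, IntegrableOn (us k) (ball (0:E2) 1) volume)
    (hu : IntegrableOn u (ball (0:E2) 1) volume)
    (hsol : ∀ k, WeakPoisson (ball (0:E2) 1) (us k) (μs k))
    (hharm : ∀ φ : E2 → ℝ, IsTest φ → tsupport φ ⊆ ball (0:E2) 1 →
      (∫ x in ball (0:E2) 1, u x * lap φ x) = 0)
    (hL1 : Tendsto (fun k => ∫ x in ball (0:E2) 1, |us k x - u x|) atTop (𝓝 0))
    (htv : Tendsto (fun k => (tv (μs k) (ball (0:E2) 1)).toReal) atTop (𝓝 0))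
    {dus : ℕ → E2 → E2} {du : E2 → E2}
    (hdus : ∀ k, IsWeakGrad (ball (0:E2) 1) (us k) (dus k))
    (hdu : IsWeakGrad (ball (0:E2) 1) u du)
    (hdi : ∀ k, ∀ ρ < 1, IntegrableOn (dus k) (ball 0 ρ))
    (hdui : ∀ ρ < 1, IntegrableOn du (ball 0 ρ)) {R q : ℝ} (hR : R < 1)
    (hq : q ∈ Ico (1:ℝ) 2) {K : Set E2} (hK : K ⊆ ball 0 R) :
    Tendsto (fun k => (∫ x in K, |us k x - u x| ^ q) + ∫ x in K, ‖dus k x - du x‖ ^ q)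
      atTop (𝓝 0) := by
  have hδ : 0 < (1 - R) / 2 := by linarith
  have hq0 : 0 < q := by linarith [hq.1]
  have hE := estConst_ne_top hδ hq
  set E := estConst ((1 - R) / 2) q with hEdef
  let c : ℕ → ℝ≥0∞ := fun k => E * (ENNReal.ofReal (tv (μs k) (ball (0:E2) 1)).toReal
    + ENNReal.ofReal (∫ x in ball (0:E2) 1, |us k x - u x|))
  have hc : ∀ k, c k ≠ ∞ := fun k => by finiteness
  have hc0 : Tendsto c atTop (𝓝 0) := by
    have h := (ENNReal.tendsto_ofReal htv).add (ENNReal.tendsto_ofReal hL1)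
    have h2 := ENNReal.Tendsto.const_mul h (Or.inr hE)
    rwa [ENNReal.ofReal_zero, add_zero, mul_zero] at h2
  have hlim : Tendsto (fun k => (c k).toReal ^ q + (c k).toReal ^ q) atTop (𝓝 0) := by
    have h1 := ((ENNReal.tendsto_toReal ENNReal.zero_ne_top).comp hc0).rpow_const
      (p := q) (Or.inr hq0.le)
    have h2 := h1.add h1
    simpa [Real.zero_rpow hq0.ne'] using h2
  have hest : ∀ k, eLpNorm (fun x => us k x - u x) (ENNReal.ofReal q)
        (volume.restrict (ball 0 R))
      + eLpNorm (fun x => dus k x - du x) (ENNReal.ofReal q) (volume.restrict (ball 0 R))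
      ≤ c k := fun k => by
    have hvsol : WeakPoisson (ball 0 1) (fun x => us k x - u x) (μs k) := fun φ hφ hs => by
      simp only [sub_mul]
      rw [integral_sub ((isTest_lap hφ).integrable_mul' (hus k))
        ((isTest_lap hφ).integrable_mul' hu), hsol k φ hφ hs, hharm φ hφ hs, sub_zero]
    have h := eLpNorm_add_weakGrad_le hδ (ρ := R) (by linarith) ((hus k).sub hu) hvsol
      ((hdus k).sub (hus k) hu hdu (hdi k) hdui) (fun ρ hρ => (hdi k ρ hρ).sub (hdui ρ hρ)) hq.1
    refine h.trans ?_
    simp only [c]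
    rw [show R + 2 * ((1 - R) / 2) = 1 by ring, ENNReal.ofReal_toReal (measure_ne_top _ _)]
    gcongr
    exact (ofReal_integral_norm_eq_lintegral_enorm ((hus k).sub hu)).ge
  refine squeeze_zero (fun k => by positivity) (fun k => add_le_add ?_ ?_) hlim
  · exact setIntegral_norm_rpow_le hq.1 hK (hc k) (le_self_add.trans (hest k))
  · exact setIntegral_norm_rpow_le hq.1 hK (hc k) (le_add_self.trans (hest k))

/-- **Lemma 2.6.** Stability of weak solutions of `-Δu = μ` under `L¹` convergence:
weak `W^{1,q}_loc` convergence in general, strong `W^{1,q}_loc` convergence and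
harmonicity of the limit when the total variations tend to `0`. -/
theorem weak_solutions_convergence
    (μs : ℕ → SignedMeasure E2) (μ : SignedMeasure E2)
    (us : ℕ → E2 → ℝ) (u : E2 → ℝ)
    (hus : ∀ k, IntegrableOn (us k) (ball (0:E2) 1) volume)
    (hu : IntegrableOn u (ball (0:E2) 1) volume)
    (hsol : ∀ k, WeakPoisson (ball (0:E2) 1) (us k) (μs k))
    (hμconv : ∀ φ : E2 → ℝ, Continuous φ → HasCompactSupport φ →
      tsupport φ ⊆ ball (0:E2) 1 →
      Tendsto (fun k => sInt (μs k) φ) atTop (𝓝 (sInt μ φ)))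
    (hL1 : Tendsto (fun k => ∫ x in ball (0:E2) 1, |us k x - u x|) atTop (𝓝 0)) :
    -- (1)
    (WeakPoisson (ball (0:E2) 1) u μ ∧
      ∀ q ∈ Set.Ioo (1:ℝ) 2,
        ∃ (dus : ℕ → E2 → E2) (du : E2 → E2),
          (∀ k, IsWeakGrad (ball (0:E2) 1) (us k) (dus k)) ∧
          IsWeakGrad (ball (0:E2) 1) u du ∧
          ∀ K : Set E2, IsCompact K → K ⊆ ball (0:E2) 1 →
            (∃ M : ℝ, ∀ k,
              (∫ x in K, |us k x| ^ q) + (∫ x in K, ‖dus k x‖ ^ q) ≤ M) ∧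
            (∀ Φ : E2 → E2, Continuous Φ → (∀ x, x ∉ K → Φ x = 0) →
              Tendsto (fun k => ∫ x in ball (0:E2) 1, ip (dus k x) (Φ x)) atTop
                (𝓝 (∫ x in ball (0:E2) 1, ip (du x) (Φ x))))) ∧
    -- (2)
    (Tendsto (fun k => (tv (μs k) (ball (0:E2) 1)).toReal) atTop (𝓝 0) →
      (∀ q ∈ Set.Ico (1:ℝ) 2,
        ∃ (dus : ℕ → E2 → E2) (du : E2 → E2),
          (∀ k, IsWeakGrad (ball (0:E2) 1) (us k) (dus k)) ∧
          IsWeakGrad (ball (0:E2) 1) u du ∧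
          ∀ K : Set E2, IsCompact K → K ⊆ ball (0:E2) 1 →
            Tendsto (fun k =>
                (∫ x in K, |us k x - u x| ^ q) + ∫ x in K, ‖dus k x - du x‖ ^ q)
              atTop (𝓝 0)) ∧
      (∀ φ : E2 → ℝ, IsTest φ → tsupport φ ⊆ ball (0:E2) 1 →
        (∫ x in ball (0:E2) 1, u x * lap φ x) = 0)) := by
  have hP : WeakPoisson (ball (0:E2) 1) u μ := WeakPoisson.of_tendsto hus hu hsol hμconv hL1
  have hb : ∀ φ : E2 → ℝ, Continuous φ → HasCompactSupport φ → tsupport φ ⊆ ball (0:E2) 1 →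
      ∃ C, ∀ k, |sInt (μs k) φ| ≤ C := fun φ h1 h2 h3 => by
    obtain ⟨C, hC⟩ := (hμconv φ h1 h2 h3).abs.bddAbove_range
    exact ⟨C, fun k => hC ⟨k, rfl⟩⟩
  choose dus hdus hdi using fun k => exists_weakGrad (hus k) (hsol k)
  obtain ⟨du, hdu, hdui⟩ := exists_weakGrad hu hP
  refine ⟨⟨hP, fun q hq => ⟨dus, du, hdus, hdu, fun K hK hK1 => ?_⟩⟩, fun htv => ?_⟩
  · obtain ⟨R, hR, hKR⟩ := exists_lt_subset_ball hK.isClosed hK1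
    constructor
    · obtain ⟨c, hc, hbound⟩ := exists_eLpNorm_add_weakGrad_le hus hu hsol hb hL1 hdus hdi hR
        ⟨hq.1.le, hq.2⟩
      exact ⟨c.toReal ^ q + c.toReal ^ q, fun k => add_le_add
        (setIntegral_norm_rpow_le hq.1.le hKR hc (le_self_add.trans (hbound k)))
        (setIntegral_norm_rpow_le hq.1.le hKR hc (le_add_self.trans (hbound k)))⟩
    · obtain ⟨c, hc, hbound⟩ := exists_eLpNorm_add_weakGrad_le hus hu hsol hb hL1 hdus hdi hR
        (q := 1) ⟨le_rfl, by norm_num⟩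
      intro Φ hΦ hΦK
      refine tendsto_integral_ip hus hu hL1 hdus hdu hR (fun k => hdi k R hR) (hdui R hR)
        (C := c.toReal) (fun k => ?_) hK hKR hΦ hΦK
      have := setIntegral_norm_rpow_le le_rfl Subset.rfl hc (le_add_self.trans (hbound k))
      simpa only [Real.rpow_one] using this
  · have hharm : ∀ φ : E2 → ℝ, IsTest φ → tsupport φ ⊆ ball (0:E2) 1 →
        (∫ x in ball (0:E2) 1, u x * lap φ x) = 0 := fun φ hφ hs => by
      obtain ⟨C, hC⟩ := hφ.continuous.bounded_above_of_compact_support hφ.2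
      have h0 : Tendsto (fun k => sInt (μs k) φ) atTop (𝓝 0) := by
        refine squeeze_zero_norm (fun k => abs_sInt_le_tv_ball hC hs) ?_
        simpa using htv.const_mul C
      rw [hP φ hφ hs, tendsto_nhds_unique (hμconv φ hφ.continuous hφ.2 hs) h0, neg_zero]
    refine ⟨fun q hq => ⟨dus, du, hdus, hdu, fun K hK hK1 => ?_⟩, hharm⟩
    obtain ⟨R, hR, hKR⟩ := exists_lt_subset_ball hK.isClosed hK1
    exact tendsto_setIntegral_rpow_sub hus hu hsol hharm hL1 htv hdus hdu hdi hdui hR hq hKR
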